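/- arXiv:2603.00032 — 6 statements merged into one kernel-verified Lean document; each statement's English description precedes it below -/
import Mathlib

section
/- Let g : ℝ → ℝ be a smooth even function. Then there exists a smooth function h : ℝ → ℝ such that g(t) = h(t²) for all t. -/
open Set Filter Topology
open scoped ContDiff

/-- A function sitting at the start of a sequence of successive derivatives is smooth. -/
lemma contDiff_infty_of_hasDerivAt_succ {F : ℕ → ℝ → ℝ}
    (hF : ∀ k x, HasDerivAt (F k) (F (k + 1) x) x) : ContDiff ℝ ∞ (F 0) := by
  have key : ∀ k, iteratedDeriv k (F 0) = F k := by
    intro k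
    induction k with
    | zero => exact iteratedDeriv_zero
    | succ k ih =>
      rw [iteratedDeriv_succ, ih]
      exact funext fun x => (hF k x).deriv
  refine contDiff_of_differentiable_iteratedDeriv fun k _ => ?_
  rw [key k]
  exact fun x => (hF k x).differentiableAt

lemma hasDerivAt_integral_pow_mul_comp_mul {f : ℝ → ℝ} (hf : ContDiff ℝ 1 f) (k : ℕ) (t : ℝ) :
    HasDerivAt (fun t => ∫ s in (0 : ℝ)..1, s ^ k * f (s * t))
      (∫ s in (0 : ℝ)..1, s ^ (k + 1) * deriv f (s * t)) t := by
  have hc : Continuous f := hf.continuous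
  have hc' : Continuous (deriv f) := hf.continuous_deriv le_rfl
  obtain ⟨C, hC⟩ := (isCompact_closedBall (0 : ℝ) (|t| + 1)).exists_bound_of_continuousOn
    hc'.continuousOn
  refine (intervalIntegral.hasDerivAt_integral_of_dominated_loc_of_deriv_le
    (F' := fun t s => s ^ (k + 1) * deriv f (s * t)) (bound := fun _ => C)
    (Metric.ball_mem_nhds t one_pos) (Eventually.of_forall fun x => ?_) ?_ ?_ ?_ ?_ ?_).2
  · exact Continuous.aestronglyMeasurable (by fun_prop)
  · exact Continuous.intervalIntegrable (by fun_prop) _ _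
  · exact Continuous.aestronglyMeasurable (by fun_prop)
  · refine Eventually.of_forall fun s hs x hx => ?_
    rw [uIoc_of_le zero_le_one] at hs
    have hxt : |x| ≤ |t| + 1 := by
      have h₁ : |x - t| < 1 := by simpa [Real.dist_eq] using hx
      have h₂ := abs_sub_abs_le_abs_sub x t
      linarith
    have hsx : s * x ∈ Metric.closedBall (0 : ℝ) (|t| + 1) := by
      rw [mem_closedBall_zero_iff, Real.norm_eq_abs, abs_mul, abs_of_pos hs.1]
      exact (mul_le_of_le_one_left (abs_nonneg x) hs.2).trans hxt
    rw [norm_mul, norm_pow, Real.norm_of_nonneg hs.1.le]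
    exact (mul_le_of_le_one_left (norm_nonneg _) (pow_le_one₀ hs.1.le hs.2)).trans (hC _ hsx)
  · exact intervalIntegrable_const
  · refine Eventually.of_forall fun s _ x _ => ?_
    have h₁ : HasDerivAt (fun x : ℝ => s * x) s x := by
      simpa using (hasDerivAt_id x).const_mul s
    have h₂ := (hf.differentiable one_ne_zero (s * x)).hasDerivAt.comp x h₁
    exact (h₂.const_mul (s ^ k)).congr_deriv (by ring)

/-- **Hadamard's lemma** on the real line. -/
lemma ContDiff.exists_eq_mul_of_map_zero {f : ℝ → ℝ} (hf : ContDiff ℝ ∞ f) (h0 : f 0 = 0) :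
    ∃ q : ℝ → ℝ, ContDiff ℝ ∞ q ∧ ∀ t, f t = t * q t := by
  have hsmooth : ∀ k, ContDiff ℝ 1 (iteratedDeriv k f) := fun k =>
    (contDiff_nat_succ_iff_contDiff_one_iteratedDeriv.1
      (hf.of_le (by exact_mod_cast le_top))).2
  refine ⟨fun t => ∫ s in (0 : ℝ)..1, s ^ 0 * iteratedDeriv 1 f (s * t), ?_, fun t => ?_⟩
  · refine contDiff_infty_of_hasDerivAt_succ
      (F := fun k t => ∫ s in (0 : ℝ)..1, s ^ k * iteratedDeriv (k + 1) f (s * t)) fun k t => ?_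
    simpa only [← iteratedDeriv_succ] using hasDerivAt_integral_pow_mul_comp_mul
      (hsmooth (k + 1)) k t
  · have hc' : Continuous (deriv f) := hf.continuous_deriv (by simp)
    simp only [pow_zero, one_mul, iteratedDeriv_one]
    rw [intervalIntegral.mul_integral_comp_mul_right,
      intervalIntegral.integral_deriv_eq_sub
        (fun x _ => hf.differentiable (by simp) x) (hc'.intervalIntegrable _ _)]
    simp [h0]

lemma exists_even_deriv_eq {g : ℝ → ℝ} (hg : ContDiff ℝ ∞ g) (heven : ∀ t, g (-t) = g t) :
    ∃ q : ℝ → ℝ, (ContDiff ℝ ∞ q ∧ ∀ t, q (-t) = q t) ∧ ∀ t, deriv g t = 2 * t * q t := by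
  have hodd : ∀ t, deriv g (-t) = -deriv g t := by
    intro t
    have h := deriv_comp_neg g t
    rw [funext heven] at h
    linarith
  have h0 : deriv g 0 = 0 := by
    have h := hodd 0
    rw [neg_zero] at h
    linarith
  obtain ⟨q, hq, hgq⟩ :=
    (contDiff_infty_iff_deriv.1 hg).2.exists_eq_mul_of_map_zero h0
  refine ⟨fun t => q t / 2, ⟨hq.div_const 2, fun t => ?_⟩, fun t => by rw [hgq]; ring⟩
  rcases eq_or_ne t 0 with rfl | ht
  · simp
  · have h := hodd t
    rw [hgq, hgq] at h
    have : q (-t) = q t := mul_left_cancel₀ ht (by linarith)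
    simp only [this]

/-- The terms of the series in Borel's lemma: a smooth function with a prescribed monomial germ at
`0` whose derivatives of order less than the degree are small, and all of whose derivatives are
bounded. -/
lemma exists_contDiff_eventuallyEq_monomial (c : ℝ) (k : ℕ) {ε : ℝ} (hε : 0 < ε) :
    ∃ f : ℝ → ℝ, ContDiff ℝ ∞ f ∧ f =ᶠ[𝓝 0] (fun x => c * x ^ k) ∧
      (∀ n, ∃ C, ∀ x, ‖iteratedDeriv n f x‖ ≤ C) ∧
      ∀ n < k, ∀ x, ‖iteratedDeriv n f x‖ ≤ ε := by
  let χ : ContDiffBump (0 : ℝ) := default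
  let ψ : ℝ → ℝ := fun x => c * x ^ k * χ x
  have hψ : ContDiff ℝ ∞ ψ :=
    (contDiff_const.mul (contDiff_id.pow k)).mul χ.contDiff
  have hsupp : HasCompactSupport ψ := χ.hasCompactSupport.mul_left
  have hbound : ∀ n, ∃ C, ∀ x, ‖iteratedDeriv n ψ x‖ ≤ C := by
    intro n
    obtain ⟨C, hC⟩ := (hsupp.iteratedFDeriv (𝕜 := ℝ) n).exists_bound_of_continuous
      (hψ.continuous_iteratedFDeriv (by exact_mod_cast le_top))
    exact ⟨C, fun x => by rw [← norm_iteratedFDeriv_eq_norm_iteratedDeriv]; exact hC x⟩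
  choose C hC using hbound
  have hC0 : ∀ n, 0 ≤ C n := fun n => (norm_nonneg _).trans (hC n 0)
  let M : ℝ := ∑ n ∈ Finset.range k, C n
  have hM0 : 0 ≤ M := Finset.sum_nonneg fun n _ => hC0 n
  let r : ℝ := 1 + M / ε
  have hr1 : 1 ≤ r := le_add_of_nonneg_right (by positivity)
  have hr0 : 0 < r := one_pos.trans_le hr1
  have hMr : M ≤ ε * r := by
    have : ε * r = ε + M := by simp only [r]; field_simp
    linarith
  have hderiv : ∀ n x, iteratedDeriv n (fun x => (r ^ k)⁻¹ * ψ (r * x)) x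
      = (r ^ k)⁻¹ * (r ^ n * iteratedDeriv n ψ (r * x)) := by
    intro n x
    rw [iteratedDeriv_const_mul_field, iteratedDeriv_comp_const_mul
      (hψ.of_le (by exact_mod_cast le_top))]
  refine ⟨fun x => (r ^ k)⁻¹ * ψ (r * x), by fun_prop, ?_, fun n => ?_, fun n hn x => ?_⟩
  · have ht : Tendsto (fun x : ℝ => r * x) (𝓝 0) (𝓝 0) := by
      have : Continuous fun x : ℝ => r * x := by fun_prop
      simpa using this.tendsto 0
    filter_upwards [ht.eventually χ.eventuallyEq_one] with x hx
    have hx' : χ (r * x) = 1 := hx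
    simp only [ψ, hx', mul_pow]
    field_simp
  · refine ⟨(r ^ k)⁻¹ * (r ^ n * C n), fun x => ?_⟩
    rw [hderiv, norm_mul, norm_mul, Real.norm_of_nonneg (by positivity),
      Real.norm_of_nonneg (by positivity)]
    gcongr
    exact hC n _
  · rw [hderiv, norm_mul, norm_mul, Real.norm_of_nonneg (by positivity),
      Real.norm_of_nonneg (by positivity), inv_mul_le_iff₀ (by positivity)]
    calc r ^ n * ‖iteratedDeriv n ψ (r * x)‖ ≤ r ^ n * M := by
          gcongr
          exact (hC n _).trans
            (Finset.single_le_sum (fun i _ => hC0 i) (Finset.mem_range.2 hn))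
      _ ≤ r ^ n * (ε * r) := by gcongr
      _ = r ^ (n + 1) * ε := by ring
      _ ≤ r ^ k * ε := by
          gcongr
          exact hn

/-- **Borel's lemma** on the real line: every sequence is the sequence of derivatives at `0` of a
smooth function. -/
lemma exists_contDiff_iteratedDeriv_zero_eq (a : ℕ → ℝ) :
    ∃ b : ℝ → ℝ, ContDiff ℝ ∞ b ∧ ∀ n, iteratedDeriv n b 0 = a n := by
  choose f hf hgerm hbdd hsmall using fun k : ℕ =>
    exists_contDiff_eventuallyEq_monomial (a k / k.factorial) k
      (ε := (1 / 2 : ℝ) ^ k) (by positivity)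
  choose C hC using hbdd
  let v : ℕ → ℕ → ℝ := fun n k => if n < k then (1 / 2 : ℝ) ^ k else C k n
  have hv : ∀ n : ℕ, (n : ℕ∞) ≤ ⊤ → Summable (v n) := by
    intro n _
    refine (summable_congr_atTop ?_).2 summable_geometric_two
    filter_upwards [eventually_gt_atTop n] with k hk
    simp [v, hk]
  have hfv : ∀ (n k : ℕ) (x : ℝ), (n : ℕ∞) ≤ ⊤ → ‖iteratedFDeriv ℝ n (f k) x‖ ≤ v n k := by
    intro n k x _
    rw [norm_iteratedFDeriv_eq_norm_iteratedDeriv]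
    by_cases h : n < k
    · simpa only [v, if_pos h] using hsmall k n h x
    · simpa only [v, if_neg h] using hC k n x
  refine ⟨fun x => ∑' k, f k x, contDiff_tsum hf hv hfv, fun n => ?_⟩
  have hsum : Summable fun k => iteratedFDeriv ℝ n (f k) 0 :=
    .of_norm_bounded (hv n le_top) fun k => hfv n k 0 le_top
  have hterm : ∀ k, iteratedDeriv n (f k) 0 = if k = n then a n else 0 := by
    intro k
    rw [(hgerm k).iteratedDeriv_eq, iteratedDeriv_const_mul_field, iteratedDeriv_fun_pow_zero]
    split_ifs with h₁ h₂ h₂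
    · subst h₁
      field_simp
    · exact absurd h₁.symm h₂
    · exact absurd h₂.symm h₁
    · simp
  rw [iteratedDeriv_eq_iteratedFDeriv, iteratedFDeriv_tsum_apply hf hv hfv le_top,
    ContinuousMultilinearMap.tsum_eval hsum]
  simp only [← iteratedDeriv_eq_iteratedFDeriv, hterm, tsum_ite_eq]

/-- Whitney's theorem on even functions: a smooth even function `g : ℝ → ℝ`
can be written `g(t) = h(t²)` with `h` smooth. -/
theorem stmt_4 (g : ℝ → ℝ) (hg : ContDiff ℝ (⊤ : ℕ∞) g) (heven : ∀ t, g (-t) = g t) :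
    ∃ h : ℝ → ℝ, ContDiff ℝ (⊤ : ℕ∞) h ∧ ∀ t, g t = h (t ^ 2) := by
  choose! T hT hTderiv using fun (f : ℝ → ℝ) (hf : ContDiff ℝ ∞ f ∧ ∀ t, f (-t) = f t) =>
    exists_even_deriv_eq hf.1 hf.2
  let G : ℕ → ℝ → ℝ := fun k => T^[k] g
  have hGsucc : ∀ k, G (k + 1) = T (G k) := fun k => Function.iterate_succ_apply' T k g
  have hG : ∀ k, ContDiff ℝ ∞ (G k) ∧ ∀ t, G k (-t) = G k t := by
    intro k
    induction k with
    | zero => exact ⟨hg, heven⟩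
    | succ k ih => rw [hGsucc]; exact hT _ ih
  obtain ⟨b, hb, hb0⟩ := exists_contDiff_iteratedDeriv_zero_eq fun k => G k 0
  let H : ℕ → ℝ → ℝ := fun k x => if 0 ≤ x then G k (√x) else iteratedDeriv k b x
  have hHcont : ∀ k, Continuous (H k) := by
    intro k
    refine Continuous.if_le ((hG k).1.continuous.comp Real.continuous_sqrt)
      (hb.continuous_iteratedDeriv k (by exact_mod_cast le_top)) continuous_const continuous_id ?_
    rintro x rfl
    simp [hb0]
  have hHderiv : ∀ k x, HasDerivAt (H k) (H (k + 1) x) x := by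
    intro k
    refine hasDerivAt_of_hasDerivAt_of_ne' (x := 0) (fun x hx => ?_) (hHcont k).continuousAt
      (hHcont (k + 1)).continuousAt
    rcases hx.lt_or_gt with hneg | hpos
    · have h₁ : HasDerivAt (iteratedDeriv k b) (iteratedDeriv (k + 1) b x) x := by
        rw [iteratedDeriv_succ]
        exact (hb.differentiable_iteratedDeriv k (by exact_mod_cast ENat.natCast_lt_top k)
          x).hasDerivAt
      have h₂ : H (k + 1) x = iteratedDeriv (k + 1) b x := if_neg hneg.not_ge
      rw [h₂]
      refine h₁.congr_of_eventuallyEq ?_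
      filter_upwards [Iio_mem_nhds hneg] with y hy
      exact if_neg (not_le.2 hy)
    · have hsqrt : √x ≠ 0 := (Real.sqrt_pos.2 hpos).ne'
      have h₁ := ((hG k).1.differentiable (by simp) (√x)).hasDerivAt.comp x
        (Real.hasDerivAt_sqrt hpos.ne')
      have h₂ : H (k + 1) x = G (k + 1) (√x) := if_pos hpos.le
      rw [h₂]
      refine (h₁.congr_deriv ?_).congr_of_eventuallyEq ?_
      · rw [hTderiv _ (hG k), hGsucc]
        field_simp
      · filter_upwards [Ioi_mem_nhds hpos] with y hy
        exact if_pos (le_of_lt hy)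
  refine ⟨H 0, contDiff_infty_of_hasDerivAt_succ hHderiv, fun t => ?_⟩
  have h₁ : H 0 (t ^ 2) = g |t| := by
    simp only [H, if_pos (sq_nonneg t), Real.sqrt_sq_eq_abs]
    rfl
  rw [h₁]
  rcases abs_choice t with h | h
  · rw [h]
  · rw [h, heven]
end

section
/- Let f : (0,∞) → ℝ be a function such that the function g : ℝ → ℝ defined by g(t) = 4·t²·f(t²) for t ≠ 0 and g(0) = c (for some real c) is smooth on ℝ. Then there exist a constant a ∈ ℝ and a smooth function r : ℝ → ℝ such that f(x) = a/x + r(x) for all x > 0. -/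
open Filter Topology Asymptotics

/-- Taylor's theorem at `0`, with the coefficients written as iterated derivatives. -/
lemma isLittleO_sub_taylor_zero {φ : ℝ → ℝ} {n : ℕ} (hφ : ContDiff ℝ n φ) :
    (fun x => φ x - ∑ k ∈ Finset.range (n + 1), iteratedDeriv k φ 0 / k.factorial * x ^ k)
      =o[𝓝 0] fun x => x ^ n := by
  have h := taylor_isLittleO_univ (x₀ := 0) hφ
  simp only [taylor_within_apply, sub_zero, iteratedDerivWithin_univ, smul_eq_mul] at h
  refine h.congr_left fun x => ?_
  congr 1
  exact Finset.sum_congr rfl fun k _ => by ring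

lemma isLittleO_pow_of_iteratedDeriv_eq_zero {φ : ℝ → ℝ} (hφ : ContDiff ℝ (⊤ : ℕ∞) φ)
    (h0 : ∀ n, iteratedDeriv n φ 0 = 0) (n : ℕ) : φ =o[𝓝 0] fun x => x ^ n := by
  simpa [h0] using isLittleO_sub_taylor_zero (n := n) (contDiff_infty.1 hφ n)

lemma iteratedDeriv_eq_zero_of_isLittleO_pow {φ : ℝ → ℝ} (hφ : ContDiff ℝ (⊤ : ℕ∞) φ)
    (ho : ∀ n : ℕ, φ =o[𝓝 0] fun x => x ^ n) (n : ℕ) : iteratedDeriv n φ 0 = 0 := by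
  induction n using Nat.strong_induction_on with
  | _ n ih =>
    have h := isLittleO_sub_taylor_zero (n := n) (contDiff_infty.1 hφ n)
    have hsum : ∀ x : ℝ, ∑ k ∈ Finset.range (n + 1), iteratedDeriv k φ 0 / k.factorial * x ^ k =
        iteratedDeriv n φ 0 / n.factorial * x ^ n := fun x => by
      rw [Finset.sum_range_succ, Finset.sum_eq_zero, zero_add]
      intro k hk
      rw [ih k (Finset.mem_range.1 hk), zero_div, zero_mul]
    simp only [hsum] at h
    have h1 : (fun x : ℝ => iteratedDeriv n φ 0 / n.factorial * x ^ n) =o[𝓝 0] fun x => x ^ n :=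
      ((ho n).sub h).congr_left fun x => by ring
    by_contra hne
    have hc : iteratedDeriv n φ 0 / n.factorial ≠ 0 :=
      div_ne_zero hne (Nat.cast_ne_zero.2 n.factorial_ne_zero)
    have h2 : (fun x : ℝ => x ^ n) =o[𝓝 0] fun x => x ^ n :=
      (isLittleO_const_mul_left_iff hc).1 h1
    have hev : ∀ᶠ x : ℝ in 𝓝[≠] 0, x ^ n ≠ 0 :=
      eventually_mem_nhdsWithin.mono fun x hx => pow_ne_zero n hx
    exact isLittleO_irrefl hev.frequently (h2.mono nhdsWithin_le_nhds)

/-- If `φ` is smooth and flat at `0`, then `φ (√x) / √x ^ k` is differentiable everywhere, its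
derivative being a combination of functions of the same shape. -/
lemma hasDerivAt_comp_sqrt_div_pow {φ : ℝ → ℝ} (hφ : ContDiff ℝ (⊤ : ℕ∞) φ)
    (h0 : ∀ n, iteratedDeriv n φ 0 = 0) (k : ℕ) (x : ℝ) :
    HasDerivAt (fun x => φ (√x) / √x ^ k)
      (1 / 2 * (deriv φ (√x) / √x ^ (k + 1)) - k / 2 * (φ (√x) / √x ^ (k + 2))) x := by
  have hφ0 : φ 0 = 0 := by simpa using h0 0
  have hφ1 : deriv φ 0 = 0 := by simpa using h0 1
  rcases lt_trichotomy x 0 with hx | rfl | hx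
  · have hev : (fun x => φ (√x) / √x ^ k) =ᶠ[𝓝 x] fun _ => 0 := by
      filter_upwards [gt_mem_nhds hx] with y hy
      simp [Real.sqrt_eq_zero_of_nonpos hy.le, hφ0]
    simpa [Real.sqrt_eq_zero_of_nonpos hx.le, hφ0, hφ1] using
      (hasDerivAt_const x (0 : ℝ)).congr_of_eventuallyEq hev
  · have hs : Tendsto Real.sqrt (𝓝 0) (𝓝 0) := by
      simpa using Real.continuous_sqrt.tendsto 0
    have h := (isLittleO_pow_of_iteratedDeriv_eq_zero hφ h0 (k + 2)).comp_tendsto hs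
    rw [hasDerivAt_iff_isLittleO]
    simp only [Real.sqrt_zero, hφ0, hφ1, zero_div, mul_zero, sub_zero, smul_zero]
    rw [isLittleO_iff] at h ⊢
    intro ε hε
    filter_upwards [h hε] with x hx
    rcases le_or_gt x 0 with hx0 | hx0
    · simp only [Real.sqrt_eq_zero_of_nonpos hx0, hφ0, zero_div, norm_zero]
      positivity
    · have hs := Real.sqrt_pos.2 hx0
      simp only [Function.comp_apply, norm_pow, Real.norm_eq_abs, abs_of_pos hs] at hx
      rw [norm_div, norm_pow, Real.norm_eq_abs, Real.norm_eq_abs, Real.norm_eq_abs,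
        abs_of_pos hs, abs_of_pos hx0, div_le_iff₀ (by positivity)]
      calc |φ √x| ≤ ε * √x ^ (k + 2) := hx
        _ = ε * √x ^ 2 * √x ^ k := by ring
        _ = ε * x * √x ^ k := by rw [Real.sq_sqrt hx0.le]
  · have hs := Real.sqrt_pos.2 hx
    have hd : HasDerivAt φ (deriv φ √x) √x :=
      (hφ.differentiable (by simp) _).hasDerivAt
    have hq := Real.hasDerivAt_sqrt hx.ne'
    refine ((hd.comp x hq).div (hq.pow k) (pow_pos hs k).ne').congr_deriv ?_
    rcases k with _ | k
    · simp
      field_simp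
    · simp only [Nat.add_sub_cancel, Function.comp_apply, Pi.pow_apply]
      field_simp
      ring

lemma contDiff_comp_sqrt_div_pow {φ : ℝ → ℝ} (hφ : ContDiff ℝ (⊤ : ℕ∞) φ)
    (h0 : ∀ n, iteratedDeriv n φ 0 = 0) (k : ℕ) :
    ContDiff ℝ (⊤ : ℕ∞) fun x => φ (√x) / √x ^ k := by
  refine contDiff_infty.2 fun n => ?_
  induction n generalizing φ k with
  | zero =>
    exact contDiff_zero.2 (continuous_iff_continuousAt.2 fun x =>
      (hasDerivAt_comp_sqrt_div_pow hφ h0 k x).continuousAt)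
  | succ n ih =>
    have hd := hasDerivAt_comp_sqrt_div_pow hφ h0 k
    rw [Nat.cast_add, Nat.cast_one, contDiff_succ_iff_deriv]
    refine ⟨fun x => (hd x).differentiableAt, by simp, ?_⟩
    rw [funext fun x => (hd x).deriv]
    have hφ' := (contDiff_infty_iff_deriv.1 hφ).2
    have h0' : ∀ n, iteratedDeriv n (deriv φ) 0 = 0 := fun n => by
      rw [← iteratedDeriv_succ', h0]
    exact (contDiff_const.mul (ih hφ' h0' (k + 1))).sub (contDiff_const.mul (ih hφ h0 (k + 2)))

/-- A smooth function equal to `c * x ^ k` near `0`, with small derivatives of order `< k`. -/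
lemma exists_contDiff_eq_monomial_small (c : ℝ) (k : ℕ) :
    ∃ u : ℝ → ℝ, ContDiff ℝ (⊤ : ℕ∞) u ∧ (∀ᶠ x in 𝓝 0, u x = c * x ^ k) ∧
      (∀ j < k, ∀ x, ‖iteratedFDeriv ℝ j u x‖ ≤ (1 / 2) ^ k) ∧
      (0 < k → ∀ x, |u x| ≤ (1 / 2) ^ k * |x| ^ (k - 1)) := by
  obtain ⟨χ⟩ : Nonempty (ContDiffBump (0 : ℝ)) := inferInstance
  let w : ℕ → ℝ → ℝ := fun m y => y ^ m * χ y
  have hw : ∀ m, ContDiff ℝ (⊤ : ℕ∞) (w m) := fun m => (contDiff_id.pow m).mul χ.contDiff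
  have hbd : ∀ m j, ∃ M, ∀ y, ‖iteratedFDeriv ℝ j (w m) y‖ ≤ M := fun m j =>
    ((χ.hasCompactSupport.mul_left).iteratedFDeriv j).exists_bound_of_continuous
      ((hw m).continuous_iteratedFDeriv (by exact_mod_cast le_top))
  choose M hM using hbd
  have hM0 : ∀ m j, 0 ≤ M m j := fun m j => (norm_nonneg _).trans (hM m j 0)
  set S := M 1 0 + ∑ j ∈ Finset.range k, M k j
  have hsum : 0 ≤ ∑ j ∈ Finset.range k, M k j := Finset.sum_nonneg fun j _ => hM0 k j
  have hS0 : 0 ≤ S := add_nonneg (hM0 1 0) hsum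
  set L : ℝ := 1 + |c| * S * 2 ^ k with hL
  have hL1 : 1 ≤ L := le_add_of_nonneg_right (by positivity)
  have hL0 : 0 < L := one_pos.trans_le hL1
  have hkey : |c| * S * L⁻¹ ≤ (1 / 2) ^ k := by
    rw [← div_eq_mul_inv, div_le_iff₀ hL0, hL, one_div, inv_pow]
    have : (0 : ℝ) < 2 ^ k := by positivity
    field_simp
    linarith
  refine ⟨fun x => c * (L ^ k)⁻¹ * w k (L * x), ?_, ?_, ?_, ?_⟩
  · exact contDiff_const.mul ((hw k).comp (contDiff_const.mul contDiff_id))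
  · have ht : Tendsto (fun x : ℝ => L * x) (𝓝 0) (𝓝 0) := by
      simpa using (continuous_const_mul L).tendsto 0
    filter_upwards [ht.eventually χ.eventuallyEq_one] with x hx
    simp only [w, hx, Pi.one_apply, mul_pow]
    field_simp
  · intro j hj x
    rw [norm_iteratedFDeriv_eq_norm_iteratedDeriv, iteratedDeriv_const_mul_field,
      iteratedDeriv_comp_const_mul ((hw k).of_le (by exact_mod_cast le_top))]
    have h1 : |iteratedDeriv j (w k) (L * x)| ≤ S := by
      have := hM k j (L * x)
      rw [norm_iteratedFDeriv_eq_norm_iteratedDeriv, Real.norm_eq_abs] at this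
      have h2 := Finset.single_le_sum (fun i _ => hM0 k i) (Finset.mem_range.2 hj)
      linarith [hM0 1 0]
    have h2 : (L ^ k)⁻¹ * L ^ j ≤ L⁻¹ := by
      rw [inv_mul_le_iff₀ (by positivity), ← div_eq_mul_inv, le_div_iff₀ hL0, ← pow_succ]
      exact pow_le_pow_right₀ hL1 hj
    simp only [Real.norm_eq_abs, abs_mul, abs_inv, abs_pow, abs_of_pos hL0]
    calc |c| * (L ^ k)⁻¹ * (L ^ j * |iteratedDeriv j (w k) (L * x)|)
        = |c| * |iteratedDeriv j (w k) (L * x)| * ((L ^ k)⁻¹ * L ^ j) := by ring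
      _ ≤ |c| * S * L⁻¹ := by gcongr
      _ ≤ _ := hkey
  · intro hk x
    obtain ⟨m, rfl⟩ := Nat.exists_eq_succ_of_ne_zero hk.ne'
    have h1 : |w 1 (L * x)| ≤ S := by
      have := hM 1 0 (L * x)
      rw [norm_iteratedFDeriv_zero, Real.norm_eq_abs] at this
      linarith
    have h2 : c * (L ^ (m + 1))⁻¹ * w (m + 1) (L * x) = c * w 1 (L * x) * L⁻¹ * x ^ m := by
      simp only [w, mul_pow]
      field_simp
      ring
    simp only [Nat.succ_eq_add_one, Nat.add_sub_cancel]
    rw [h2]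
    simp only [abs_mul, abs_inv, abs_pow, abs_of_pos hL0]
    calc |c| * |w 1 (L * x)| * L⁻¹ * |x| ^ m ≤ |c| * S * L⁻¹ * |x| ^ m := by gcongr
      _ ≤ _ := by gcongr

/-- **Borel's lemma** on the real line: every formal power series is the asymptotic expansion at
`0` of a smooth function. -/
lemma exists_contDiff_asymptotic_expansion (c : ℕ → ℝ) :
    ∃ b : ℝ → ℝ, ContDiff ℝ (⊤ : ℕ∞) b ∧
      ∀ n, (fun x => b x - ∑ k ∈ Finset.range n, c k * x ^ k) =O[𝓝 0] fun x => x ^ n := by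
  choose u hu hev hder hbd using fun k => exists_contDiff_eq_monomial_small (c k) k
  have hgeom : Summable fun k : ℕ => (1 / 2 : ℝ) ^ k := summable_geometric_two
  refine ⟨fun x => ∑' k, u k x, ?_, fun n => ?_⟩
  · refine contDiff_tsum_of_eventually (v := fun _ k => (1 / 2 : ℝ) ^ k) hu (fun _ _ => hgeom) ?_
    intro j _
    rw [Nat.cofinite_eq_atTop]
    filter_upwards [eventually_gt_atTop j] with k hk using hder k j hk
  have htail : Summable fun k : ℕ => (1 / 2 : ℝ) ^ (k + (n + 1)) :=
    (summable_nat_add_iff (n + 1)).2 hgeom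
  have hO : (fun x => ∑' k, u (k + (n + 1)) x) =O[𝓝 0] fun x => x ^ n := by
    refine IsBigO.of_bound (∑' k : ℕ, (1 / 2 : ℝ) ^ (k + (n + 1))) ?_
    filter_upwards [Metric.ball_mem_nhds (0 : ℝ) one_pos] with x hx
    have hx1 : |x| ≤ 1 := by simpa using (Metric.mem_ball.1 hx).le
    rw [norm_pow, ← tsum_mul_right]
    refine tsum_of_norm_bounded (htail.mul_right _).hasSum fun k => ?_
    refine (hbd (k + (n + 1)) (by omega) x).trans ?_
    exact mul_le_mul_of_nonneg_left
      (pow_le_pow_of_le_one (abs_nonneg x) hx1 (by omega)) (by positivity)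
  have hterm : (fun x : ℝ => c n * x ^ n) =O[𝓝 0] fun x => x ^ n :=
    isBigO_const_mul_self _ _ _
  refine (hO.add hterm).congr' ?_ EventuallyEq.rfl
  have hall : ∀ᶠ x in 𝓝 (0 : ℝ), ∀ k ∈ Finset.range (n + 1), u k x = c k * x ^ k :=
    (Filter.eventually_all_finset _).2 fun k _ => hev k
  filter_upwards [hall] with x hx
  have hsum : Summable fun k => u k x := by
    refine (summable_nat_add_iff 1).1 (Summable.of_norm_bounded
      ((summable_nat_add_iff 1).2 hgeom) fun k => ?_)
    have := hder (k + 1) 0 (by omega) x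
    rwa [norm_iteratedFDeriv_zero] at this
  rw [← hsum.sum_add_tsum_nat_add (n + 1), Finset.sum_congr rfl hx, Finset.sum_range_succ]
  ring

/-- The Taylor polynomial of even order of an even function has only even powers. -/
lemma sum_taylor_even {g : ℝ → ℝ} (hg : ∀ t, g (-t) = g t) (n : ℕ) (t : ℝ) :
    ∑ k ∈ Finset.range (2 * n + 1), iteratedDeriv k g 0 / k.factorial * t ^ k =
      g 0 + ∑ j ∈ Finset.range n,
        iteratedDeriv (2 * j + 2) g 0 / (2 * j + 2).factorial * t ^ (2 * j + 2) := by
  have hodd : ∀ j, iteratedDeriv (2 * j + 1) g 0 = 0 := fun j => by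
    have h := iteratedDeriv_comp_neg (2 * j + 1) g 0
    rw [funext hg, neg_zero, Odd.neg_one_pow ⟨j, rfl⟩, smul_eq_mul] at h
    linarith
  induction n with
  | zero => simp
  | succ n ih =>
    rw [show 2 * (n + 1) + 1 = 2 * n + 1 + 1 + 1 by ring, Finset.sum_range_succ,
      Finset.sum_range_succ, ih, Finset.sum_range_succ _ n, hodd]
    ring

/-- Decomposition on the half-line: if `t ↦ 4t²·f(t²)` extends to a smooth
function `g` on `ℝ`, then `f(x) = a/x + r(x)` on `(0,∞)` for some constant `a`
and smooth `r : ℝ → ℝ`. -/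
theorem stmt_7 (f : ℝ → ℝ) (g : ℝ → ℝ) (hg : ContDiff ℝ (⊤ : ℕ∞) g)
    (hfg : ∀ t : ℝ, t ≠ 0 → g t = 4 * t ^ 2 * f (t ^ 2)) :
    ∃ (a : ℝ) (r : ℝ → ℝ), ContDiff ℝ (⊤ : ℕ∞) r ∧ ∀ x > 0, f x = a / x + r x := by
  have heven : ∀ t, g (-t) = g t := fun t => by
    rcases eq_or_ne t 0 with rfl | ht
    · simp
    · rw [hfg t ht, hfg (-t) (neg_ne_zero.2 ht), neg_sq]
  obtain ⟨b, hb, hbO⟩ := exists_contDiff_asymptotic_expansion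
    fun j => iteratedDeriv (2 * j + 2) g 0 / (2 * j + 2).factorial / 4
  set φ : ℝ → ℝ := fun t => g t - g 0 - 4 * t ^ 2 * b (t ^ 2) with hφdef
  have hφ : ContDiff ℝ (⊤ : ℕ∞) φ := by fun_prop
  have hsq : Tendsto (fun t : ℝ => t ^ 2) (𝓝 0) (𝓝 0) := by
    simpa using (continuous_pow 2).tendsto (0 : ℝ)
  have hone : (fun t : ℝ => 4 * t ^ 2) =o[𝓝 0] fun _ => (1 : ℝ) :=
    (isLittleO_one_iff ℝ).2 (by simpa using hsq.const_mul 4)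
  have ho : ∀ n : ℕ, φ =o[𝓝 0] fun t => t ^ n := fun n => by
    have h1 := isLittleO_sub_taylor_zero (n := 2 * n) (contDiff_infty.1 hg _)
    have h2 := hone.mul_isBigO ((hbO n).comp_tendsto hsq)
    simp only [Function.comp_def, one_mul, ← pow_mul] at h2
    have h3 : φ =o[𝓝 0] fun t => t ^ (2 * n) := by
      refine (h1.sub h2).congr_left fun t => ?_
      rw [sum_taylor_even heven, mul_sub, Finset.mul_sum, hφdef]
      have : ∀ j, 4 * t ^ 2 * (iteratedDeriv (2 * j + 2) g 0 / (2 * j + 2).factorial / 4 *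
          t ^ (2 * j)) = iteratedDeriv (2 * j + 2) g 0 / (2 * j + 2).factorial *
          t ^ (2 * j + 2) := fun j => by ring
      simp only [this]
      ring
    refine h3.trans_isBigO (IsBigO.of_bound 1 ?_)
    filter_upwards [Metric.ball_mem_nhds (0 : ℝ) one_pos] with t ht
    have ht1 : |t| ≤ 1 := by simpa using (Metric.mem_ball.1 ht).le
    rw [one_mul, norm_pow, norm_pow]
    exact pow_le_pow_of_le_one (abs_nonneg t) ht1 (by omega)
  have hflat := iteratedDeriv_eq_zero_of_isLittleO_pow hφ ho
  refine ⟨g 0 / 4, fun x => b x + 1 / 4 * (φ (√x) / √x ^ 2),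
    hb.add (contDiff_const.mul (contDiff_comp_sqrt_div_pow hφ hflat 2)), fun x hx => ?_⟩
  have h := hfg (√x) (Real.sqrt_pos.2 hx).ne'
  rw [Real.sq_sqrt hx.le] at h
  simp only [hφdef, Real.sq_sqrt hx.le, h]
  field_simp
  ring
end

section
/- Let γ̃ : ℝ² → ℝ be a smooth function that is odd in each variable separately, i.e., γ̃(-u,v) = -γ̃(u,v) and γ̃(u,-v) = -γ̃(u,v). Then there exists a smooth function K : ℝ² → ℝ such that γ̃(u,v) = u·v·K(u², v²) for all (u,v). -/
open Real Set Filter Topology MeasureTheory FourierTransform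
open scoped ContDiff

/-- There is a smooth function `C` with `C (w ^ 2) = cos w`. -/
lemma exists_contDiff_cos_sq :
    ∃ C : ℝ → ℝ, ContDiff ℝ ∞ C ∧ ∀ w : ℝ, C (w ^ 2) = cos w := by
  let c : ℕ → ℝ := fun n ↦ (-1) ^ n / (2 * n).factorial
  let p := FormalMultilinearSeries.ofScalars ℝ c
  have hrad : p.radius = ⊤ := by
    refine p.radius_eq_top_of_summable_norm fun r ↦ ?_
    refine (Real.hasSum_cosh (√r)).summable.congr fun n ↦ ?_
    rw [FormalMultilinearSeries.ofScalars_norm, pow_mul, Real.sq_sqrt r.coe_nonneg]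
    simp [c, div_eq_inv_mul]
  refine ⟨p.sum, ?_, fun w ↦ ?_⟩
  · have h := p.hasFPowerSeriesOnBall (by simp [hrad])
    rw [hrad] at h
    have h' : AnalyticOnNhd ℝ p.sum univ := by simpa using h.analyticOnNhd
    exact h'.contDiff
  · rw [← (Real.hasSum_cos w).tsum_eq]
    refine tsum_congr fun n ↦ ?_
    rw [FormalMultilinearSeries.ofScalars_apply_eq, pow_mul]
    simp only [c, smul_eq_mul]
    ring

lemma ContDiff.hasDerivAt_iteratedDeriv {f : ℝ → ℝ} (hf : ContDiff ℝ ∞ f) (k : ℕ) (r : ℝ) :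
    HasDerivAt (iteratedDeriv k f) (iteratedDeriv (k + 1) f r) r := by
  rw [iteratedDeriv_succ]
  exact (hf.differentiable_iteratedDeriv k (by exact_mod_cast ENat.natCast_lt_top k) r).hasDerivAt

lemma neg_sin_eq_of_comp_sq_eq_cos {C : ℝ → ℝ} (hC : ContDiff ℝ ∞ C)
    (hcos : ∀ w : ℝ, C (w ^ 2) = cos w) (w : ℝ) :
    -sin w = iteratedDeriv 1 C (w ^ 2) * (2 * w) := by
  have hsq : HasDerivAt (fun x : ℝ ↦ x ^ 2) (2 * w) w := by
    simpa using hasDerivAt_pow 2 w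
  refine (hasDerivAt_cos w).unique
    (((hC.hasDerivAt_iteratedDeriv 0 (w ^ 2)).comp w hsq).congr_of_eventuallyEq
      (Eventually.of_forall fun x ↦ ?_))
  simp [hcos]

/-- The differential equation satisfied by the derivatives of `r ↦ cos √r`. -/
lemma iteratedDeriv_ode_of_comp_sq_eq_cos {C : ℝ → ℝ} (hC : ContDiff ℝ ∞ C)
    (hcos : ∀ w : ℝ, C (w ^ 2) = cos w) (k : ℕ) {r : ℝ} (hr : 0 < r) :
    iteratedDeriv k C r =
      -4 * r * iteratedDeriv (k + 2) C r - (4 * k + 2) * iteratedDeriv (k + 1) C r := by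
  induction k generalizing r with
  | zero =>
    have hsq : HasDerivAt (fun x : ℝ ↦ x ^ 2) (2 * √r) (√r) := by
      simpa using hasDerivAt_pow 2 (√r)
    have h := ((hC.hasDerivAt_iteratedDeriv 1 (√r ^ 2)).comp (√r) hsq).mul
      ((hasDerivAt_id (√r)).const_mul 2)
    have h2 := (hasDerivAt_sin (√r)).neg.unique
      (h.congr_of_eventuallyEq (Eventually.of_forall fun x ↦ by
        simpa using neg_sin_eq_of_comp_sq_eq_cos hC hcos x))
    simp only [Function.comp, id, ← hcos, Real.sq_sqrt hr.le] at h2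
    have h3 : √r * √r = r := Real.mul_self_sqrt hr.le
    simp only [iteratedDeriv_zero]
    norm_num at h2 ⊢
    linear_combination -h2 - 4 * iteratedDeriv 2 C r * h3
  | succ k ih =>
    have hd := (((hasDerivAt_id r).const_mul (-4)).mul (hC.hasDerivAt_iteratedDeriv (k + 2) r)).sub
      ((hC.hasDerivAt_iteratedDeriv (k + 1) r).const_mul (4 * k + 2 : ℝ))
    have h := (hC.hasDerivAt_iteratedDeriv k r).unique
      (hd.congr_of_eventuallyEq ((lt_mem_nhds hr).mono fun x hx ↦ by simpa using ih hx))
    simp only [id, mul_one] at h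
    push_cast
    linear_combination h

lemma exists_bound_iteratedDeriv_of_comp_sq_eq_cos {C : ℝ → ℝ} (hC : ContDiff ℝ ∞ C)
    (hcos : ∀ w : ℝ, C (w ^ 2) = cos w) (k : ℕ) :
    ∃ M, ∀ r, 1 ≤ r → |iteratedDeriv k C r| ≤ M := by
  induction k using Nat.twoStepInduction with
  | zero =>
    refine ⟨1, fun r hr ↦ ?_⟩
    rw [iteratedDeriv_zero, ← Real.sq_sqrt (zero_le_one.trans hr), hcos]
    exact abs_cos_le_one _
  | one =>
    refine ⟨1, fun r hr ↦ ?_⟩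
    have hr0 : 0 ≤ r := zero_le_one.trans hr
    have h2 := neg_sin_eq_of_comp_sq_eq_cos hC hcos (√r)
    rw [Real.sq_sqrt hr0] at h2
    have h1 : 1 ≤ √r := Real.one_le_sqrt.2 hr
    have h3 : |iteratedDeriv 1 C r| * (2 * √r) ≤ 1 := by
      rw [← abs_of_nonneg (by positivity : 0 ≤ 2 * √r), ← abs_mul]
      rw [← h2, abs_neg]
      exact abs_sin_le_one _
    nlinarith [abs_nonneg (iteratedDeriv 1 C r)]
  | more k ih₀ ih₁ =>
    obtain ⟨M, hM⟩ := ih₀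
    obtain ⟨N, hN⟩ := ih₁
    refine ⟨M + (4 * k + 2) * N, fun r hr ↦ ?_⟩
    have hode := iteratedDeriv_ode_of_comp_sq_eq_cos hC hcos k (zero_lt_one.trans_le hr)
    have h : |iteratedDeriv (k + 2) C r| * (4 * r) ≤ M + (4 * k + 2) * N := by
      rw [← abs_of_nonneg (by linarith : 0 ≤ 4 * r), ← abs_mul]
      have : iteratedDeriv (k + 2) C r * (4 * r) =
          -(iteratedDeriv k C r + (4 * k + 2) * iteratedDeriv (k + 1) C r) := by
        linear_combination hode
      rw [this, abs_neg]
      refine (abs_add_le _ _).trans (add_le_add (hM r hr) ?_)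
      rw [abs_mul, abs_of_nonneg (by positivity : (0 : ℝ) ≤ 4 * k + 2)]
      exact mul_le_mul_of_nonneg_left (hN r hr) (by positivity)
    nlinarith [abs_nonneg (iteratedDeriv (k + 2) C r)]

/-- Smooth functions all of whose derivatives are bounded. -/
def BoundedDerivs (H : ℝ → ℝ) : Prop :=
  ContDiff ℝ ∞ H ∧ ∀ k, ∃ M, ∀ r, |iteratedDeriv k H r| ≤ M

lemma BoundedDerivs.deriv {H : ℝ → ℝ} (hH : BoundedDerivs H) : BoundedDerivs (deriv H) :=
  ⟨(contDiff_infty_iff_deriv.1 hH.1).2, fun k ↦ by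
    simpa only [iteratedDeriv_succ'] using hH.2 (k + 1)⟩

/-- A function with bounded derivatives that interpolates `r ↦ sin √r / √r`. -/
lemma exists_boundedDerivs_sin_sq :
    ∃ H : ℝ → ℝ, BoundedDerivs H ∧ ∀ w : ℝ, w * H (w ^ 2) = sin w := by
  obtain ⟨C, hC, hcos⟩ := exists_contDiff_cos_sq
  have hC' : ContDiff ℝ ∞ (deriv C) := (contDiff_infty_iff_deriv.1 hC).2
  let H : ℝ → ℝ := fun r ↦ smoothTransition (r + 1) * (-2 * deriv C r)
  have hH : ContDiff ℝ ∞ H :=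
    (smoothTransition.contDiff.comp (contDiff_id.add contDiff_const)).mul (contDiff_const.mul hC')
  refine ⟨H, ⟨hH, fun k ↦ ?_⟩, fun w ↦ ?_⟩
  · obtain ⟨M, hM⟩ := exists_bound_iteratedDeriv_of_comp_sq_eq_cos hC hcos (k + 1)
    obtain ⟨N, hN⟩ := isCompact_Icc.exists_bound_of_continuousOn (s := Icc (-2 : ℝ) 1)
      (hH.continuous_iteratedDeriv k (by exact_mod_cast le_top)).continuousOn
    refine ⟨max (2 * M) (max N 0), fun r ↦ ?_⟩
    rcases lt_or_ge r (-2) with hr | hr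
    · have : H =ᶠ[𝓝 r] fun _ ↦ 0 := by
        filter_upwards [gt_mem_nhds hr] with x hx
        simp [H, smoothTransition.zero_of_nonpos (by linarith : x + 1 ≤ 0)]
      rw [this.iteratedDeriv_eq]
      simp
    rcases le_or_gt r 1 with hr' | hr'
    · exact (hN r ⟨hr, hr'⟩).trans ((le_max_left _ _).trans (le_max_right _ _))
    · have : H =ᶠ[𝓝 r] fun x ↦ -2 * deriv C x := by
        filter_upwards [lt_mem_nhds hr'] with x hx
        simp [H, smoothTransition.one_of_one_le (by linarith : 1 ≤ x + 1)]
      rw [this.iteratedDeriv_eq, iteratedDeriv_const_mul_field, ← iteratedDeriv_succ', abs_mul]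
      refine le_trans ?_ (le_max_left _ _)
      have := hM r hr'.le
      norm_num
      exact this
  · have h := neg_sin_eq_of_comp_sq_eq_cos hC hcos w
    rw [iteratedDeriv_one] at h
    simp only [H, smoothTransition.one_of_one_le (by nlinarith [sq_nonneg w] : 1 ≤ w ^ 2 + 1)]
    linear_combination h

/-- Smooth functions of two variables whose support is bounded in the first variable. -/
def FiberCompact (F : ℝ × ℝ → ℂ) : Prop :=
  ContDiff ℝ ∞ F ∧ ∃ R : ℝ, ∀ x y : ℝ, R < |x| → F (x, y) = 0

namespace FiberCompact

variable {F : ℝ × ℝ → ℂ}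

lemma fderiv_apply (hF : FiberCompact F) (e : ℝ × ℝ) :
    FiberCompact fun p ↦ fderiv ℝ F p e := by
  refine ⟨(hF.1.fderiv_right (m := ∞) (by simp)).clm_apply contDiff_const, ?_⟩
  obtain ⟨R, hR⟩ := hF.2
  refine ⟨R, fun x y hx ↦ ?_⟩
  have : F =ᶠ[𝓝 (x, y)] fun _ ↦ 0 := by
    have ho : IsOpen {p : ℝ × ℝ | R < |p.1|} := isOpen_lt continuous_const (by fun_prop)
    filter_upwards [ho.mem_nhds hx] with p hp using hR p.1 p.2 hp
  simp [this.fderiv_eq]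

lemma hasDerivAt_fst (hF : FiberCompact F) (x y : ℝ) :
    HasDerivAt (fun t ↦ F (t, y)) (fderiv ℝ F (x, y) (1, 0)) x :=
  ((hF.1.differentiable (by simp) (x, y)).hasFDerivAt).comp_hasDerivAt x
    ((hasDerivAt_id x).prodMk (hasDerivAt_const x y))

lemma hasDerivAt_snd (hF : FiberCompact F) (x y : ℝ) :
    HasDerivAt (fun t ↦ F (x, t)) (fderiv ℝ F (x, y) (0, 1)) y :=
  ((hF.1.differentiable (by simp) (x, y)).hasFDerivAt).comp_hasDerivAt y
    ((hasDerivAt_const y x).prodMk (hasDerivAt_id y))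

lemma continuous_fiber (hF : FiberCompact F) (y : ℝ) : Continuous fun x ↦ F (x, y) :=
  hF.1.continuous.comp (by fun_prop)

lemma integrable_fiber (hF : FiberCompact F) (y : ℝ) : Integrable fun x ↦ F (x, y) := by
  obtain ⟨R, hR⟩ := hF.2
  refine (hF.continuous_fiber y).integrable_of_hasCompactSupport
    (HasCompactSupport.intro (isCompact_Icc (a := -R) (b := R)) fun x hx ↦ hR x y ?_)
  by_contra! h
  exact hx (abs_le.1 h)

/-- A locally uniform integrable bound for the fibers. -/
lemma exists_integrable_bound (hF : FiberCompact F) (y₀ : ℝ) :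
    ∃ b : ℝ → ℝ, Integrable b ∧ ∀ y ∈ Metric.closedBall y₀ 1, ∀ x, ‖F (x, y)‖ ≤ b x := by
  obtain ⟨R, hR⟩ := hF.2
  obtain ⟨M, hM⟩ := (isCompact_Icc (a := -R) (b := R)).prod
    (isCompact_closedBall y₀ 1) |>.exists_bound_of_continuousOn hF.1.continuous.continuousOn
  refine ⟨(Icc (-R) R).indicator fun _ ↦ M, ?_, fun y hy x ↦ ?_⟩
  · exact (integrable_indicator_iff measurableSet_Icc).2 (by simp)
  · by_cases hx : x ∈ Icc (-R) R
    · simpa [hx] using hM (x, y) ⟨hx, hy⟩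
    · rw [indicator_of_notMem hx, hR x y (by by_contra! h; exact hx (abs_le.1 h)), norm_zero]

/-- The Fourier transform in the first variable. -/
noncomputable def _root_.fiberFourier (F : ℝ × ℝ → ℂ) (ξ y : ℝ) : ℂ := 𝓕 (fun x ↦ F (x, y)) ξ

lemma continuous_fiberFourier (hF : FiberCompact F) (y : ℝ) :
    Continuous fun ξ ↦ fiberFourier F ξ y :=
  VectorFourier.fourierIntegral_continuous Real.continuous_fourierChar
    continuous_inner (hF.integrable_fiber y)

lemma fiberFourier_fderiv_fst (hF : FiberCompact F) (ξ y : ℝ) :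
    fiberFourier (fun p ↦ fderiv ℝ F p (1, 0)) ξ y =
      2 * π * Complex.I * ξ * fiberFourier F ξ y := by
  have hd : deriv (fun x ↦ F (x, y)) = fun x ↦ fderiv ℝ F (x, y) (1, 0) :=
    funext fun x ↦ (hF.hasDerivAt_fst x y).deriv
  have := Real.fourier_deriv (hF.integrable_fiber y)
    (fun x ↦ (hF.hasDerivAt_fst x y).differentiableAt)
    (hd ▸ (hF.fderiv_apply (1, 0)).integrable_fiber y)
  rw [hd] at this
  simpa [fiberFourier] using congrFun this ξ

lemma exists_bound_fiberFourier (hF : FiberCompact F) (y₀ : ℝ) :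
    ∃ M, ∀ y ∈ Metric.closedBall y₀ 1, ∀ ξ, ‖fiberFourier F ξ y‖ ≤ M := by
  obtain ⟨b, hb, hFb⟩ := hF.exists_integrable_bound y₀
  refine ⟨∫ x, b x, fun y hy ξ ↦ ?_⟩
  refine (VectorFourier.norm_fourierIntegral_le_integral_norm _ _ _ _ _).trans ?_
  exact integral_mono (hF.integrable_fiber y).norm hb (hFb y hy)

lemma sq_mul_fiberFourier (hF : FiberCompact F) (ξ y : ℝ) :
    ((2 * π * ξ) ^ 2 : ℝ) • fiberFourier F ξ y =
      -fiberFourier (fun p ↦ fderiv ℝ (fun q ↦ fderiv ℝ F q (1, 0)) p (1, 0)) ξ y := by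
  rw [(hF.fderiv_apply (1, 0)).fiberFourier_fderiv_fst, hF.fiberFourier_fderiv_fst,
    Complex.real_smul]
  push_cast
  linear_combination (2 * π * ξ) ^ 2 * fiberFourier F ξ y * Complex.I_sq

lemma exists_decay_fiberFourier (hF : FiberCompact F) (y₀ : ℝ) :
    ∃ M, ∀ y ∈ Metric.closedBall y₀ 1, ∀ ξ, ‖fiberFourier F ξ y‖ ≤ M * (1 + ξ ^ 2)⁻¹ := by
  obtain ⟨M, hM⟩ := hF.exists_bound_fiberFourier y₀
  obtain ⟨N, hN⟩ :=
    ((hF.fderiv_apply (1, 0)).fderiv_apply (1, 0)).exists_bound_fiberFourier y₀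
  refine ⟨M + N, fun y hy ξ ↦ ?_⟩
  rw [← div_eq_mul_inv, le_div_iff₀ (by positivity), mul_add, mul_one]
  refine add_le_add (hM y hy ξ) (le_trans ?_ (hN y hy ξ))
  have h := congrArg norm (hF.sq_mul_fiberFourier ξ y)
  rw [norm_smul, Real.norm_of_nonneg (sq_nonneg _), norm_neg] at h
  rw [← h, mul_comm]
  gcongr ?_ * _
  nlinarith [sq_nonneg ξ, mul_nonneg (sq_nonneg ξ) (by nlinarith [pi_gt_three] : 0 ≤ 4 * π ^ 2 - 1)]

lemma integrable_fiberFourier (hF : FiberCompact F) (y : ℝ) :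
    Integrable fun ξ ↦ fiberFourier F ξ y := by
  obtain ⟨M, hM⟩ := hF.exists_decay_fiberFourier y
  exact (integrable_inv_one_add_sq.const_mul M).mono'
    (hF.continuous_fiberFourier y).aestronglyMeasurable
    (Eventually.of_forall fun ξ ↦ hM y (Metric.mem_closedBall_self zero_le_one) ξ)

lemma hasDerivAt_fiberFourier (hF : FiberCompact F) (ξ y : ℝ) :
    HasDerivAt (fiberFourier F ξ) (fiberFourier (fun p ↦ fderiv ℝ F p (0, 1)) ξ y) y := by
  obtain ⟨b, hb, hFb⟩ := (hF.fderiv_apply (0, 1)).exists_integrable_bound y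
  have hint {G : ℝ × ℝ → ℂ} (hG : FiberCompact G) (t : ℝ) :
      Integrable fun x ↦ 𝐞 (-inner ℝ x ξ) • G (x, t) :=
    (Real.fourierIntegral_convergent_iff ξ).2 (hG.integrable_fiber t)
  exact (hasDerivAt_integral_of_dominated_loc_of_deriv_le
    (Metric.closedBall_mem_nhds y zero_lt_one)
    (Eventually.of_forall fun t ↦ (hint hF t).aestronglyMeasurable) (hint hF y)
    (hint (hF.fderiv_apply (0, 1)) y).aestronglyMeasurable
    (Eventually.of_forall fun x t ht ↦ (Circle.norm_smul _ _).trans_le (hFb t ht x)) hb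
    (Eventually.of_forall fun x t _ ↦ (hF.hasDerivAt_snd x t).const_smul _)).2

end FiberCompact

/-- Superposition of the profiles `s ↦ H (s (2πξ)²)`, weighted by the Fourier transform of `F` in
the first variable. -/
noncomputable def profileIntegral (H : ℝ → ℝ) (F : ℝ × ℝ → ℂ) (p : ℝ × ℝ) : ℂ :=
  ∫ ξ, H (p.1 * (2 * π * ξ) ^ 2) • fiberFourier F ξ p.2

lemma hasFDerivAt_profileIntegral {H : ℝ → ℝ} {F : ℝ × ℝ → ℂ} (hH : BoundedDerivs H)
    (hF : FiberCompact F) (p : ℝ × ℝ) :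
    HasFDerivAt (profileIntegral H F)
      ((ContinuousLinearMap.fst ℝ ℝ ℝ).smulRight (-profileIntegral (deriv H)
          (fun p ↦ fderiv ℝ (fun q ↦ fderiv ℝ F q (1, 0)) p (1, 0)) p) +
        (ContinuousLinearMap.snd ℝ ℝ ℝ).smulRight
          (profileIntegral H (fun p ↦ fderiv ℝ F p (0, 1)) p)) p := by
  set Fxx : ℝ × ℝ → ℂ := fun p ↦ fderiv ℝ (fun q ↦ fderiv ℝ F q (1, 0)) p (1, 0) with hFxx_def
  set Fy : ℝ × ℝ → ℂ := fun p ↦ fderiv ℝ F p (0, 1)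
  have hFxx : FiberCompact Fxx := (hF.fderiv_apply (1, 0)).fderiv_apply (1, 0)
  have hFy : FiberCompact Fy := hF.fderiv_apply (0, 1)
  have hcont {h : ℝ → ℝ} {G : ℝ × ℝ → ℂ} (hh : Continuous h) (hG : FiberCompact G) (q : ℝ × ℝ) :
      Continuous fun ξ ↦ h (q.1 * (2 * π * ξ) ^ 2) • fiberFourier G ξ q.2 :=
    (hh.comp (by fun_prop)).smul (hG.continuous_fiberFourier q.2)
  have hint {h : ℝ → ℝ} {G : ℝ × ℝ → ℂ} (hh : BoundedDerivs h) (hG : FiberCompact G)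
      (q : ℝ × ℝ) : Integrable fun ξ ↦ h (q.1 * (2 * π * ξ) ^ 2) • fiberFourier G ξ q.2 := by
    obtain ⟨M, hM⟩ := hh.2 0
    refine (hG.integrable_fiberFourier q.2).bdd_smul M
      (hh.1.continuous.comp (by fun_prop)).aestronglyMeasurable
      (Eventually.of_forall fun ξ ↦ ?_)
    simpa using hM _
  obtain ⟨M₀, hM₀⟩ := hH.2 0
  obtain ⟨M₁, hM₁⟩ := hH.deriv.2 0
  simp only [iteratedDeriv_zero] at hM₀ hM₁
  obtain ⟨A, hA⟩ := hFxx.exists_decay_fiberFourier p.2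
  obtain ⟨B, hB⟩ := hFy.exists_decay_fiberFourier p.2
  let L (v w : ℂ) : ℝ × ℝ →L[ℝ] ℂ :=
    (ContinuousLinearMap.fst ℝ ℝ ℝ).smulRight v + (ContinuousLinearMap.snd ℝ ℝ ℝ).smulRight w
  let a (q : ℝ × ℝ) (ξ : ℝ) : ℂ := deriv H (q.1 * (2 * π * ξ) ^ 2) • fiberFourier Fxx ξ q.2
  let b (q : ℝ × ℝ) (ξ : ℝ) : ℂ := H (q.1 * (2 * π * ξ) ^ 2) • fiberFourier Fy ξ q.2
  have hLint : ∫ ξ, L (-a p ξ) (b p ξ) =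
      L (-profileIntegral (deriv H) Fxx p) (profileIntegral H Fy p) := by
    have ha := hint hH.deriv hFxx p
    have hb := hint hH hFy p
    have h1 := (ContinuousLinearMap.smulRightL ℝ (ℝ × ℝ) ℂ
      (ContinuousLinearMap.fst ℝ ℝ ℝ)).integral_comp_comm ha.neg
    have h2 := (ContinuousLinearMap.smulRightL ℝ (ℝ × ℝ) ℂ
      (ContinuousLinearMap.snd ℝ ℝ ℝ)).integral_comp_comm hb
    have i1 := (ContinuousLinearMap.smulRightL ℝ (ℝ × ℝ) ℂ
      (ContinuousLinearMap.fst ℝ ℝ ℝ)).integrable_comp ha.neg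
    have i2 := (ContinuousLinearMap.smulRightL ℝ (ℝ × ℝ) ℂ
      (ContinuousLinearMap.snd ℝ ℝ ℝ)).integrable_comp hb
    refine (integral_add i1 i2).trans ?_
    rw [h1, h2]
    simp only [Pi.neg_apply, integral_neg]
    rfl
  change HasFDerivAt _ (L _ _) p
  rw [← hLint]
  refine hasFDerivAt_integral_of_dominated_of_fderiv_le (s := Metric.closedBall p 1)
    (bound := fun ξ ↦ (M₁ * A + M₀ * B) * (1 + ξ ^ 2)⁻¹)
    (F' := fun q ξ ↦ L (-a q ξ) (b q ξ))
    (Metric.closedBall_mem_nhds p zero_lt_one)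
    (Eventually.of_forall fun q ↦ (hint hH hF q).aestronglyMeasurable) (hint hH hF p)
    ?_ (Eventually.of_forall fun ξ q hq ↦ ?_) (integrable_inv_one_add_sq.const_mul _)
    (Eventually.of_forall fun ξ q _ ↦ ?_)
  · have ha : Continuous (a p) := hcont hH.deriv.1.continuous hFxx p
    have hb : Continuous (b p) := hcont hH.1.continuous hFy p
    exact Continuous.aestronglyMeasurable
      (((ContinuousLinearMap.smulRightL ℝ (ℝ × ℝ) ℂ
        (ContinuousLinearMap.fst ℝ ℝ ℝ)).continuous.comp ha.neg).add
      ((ContinuousLinearMap.smulRightL ℝ (ℝ × ℝ) ℂ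
        (ContinuousLinearMap.snd ℝ ℝ ℝ)).continuous.comp hb))
  · have hq2 : q.2 ∈ Metric.closedBall p.2 1 :=
      (le_max_right _ _).trans (Metric.mem_closedBall.1 hq)
    have ha : ‖a q ξ‖ ≤ M₁ * (A * (1 + ξ ^ 2)⁻¹) := by
      rw [norm_smul]
      exact mul_le_mul (hM₁ _) (hA _ hq2 ξ) (norm_nonneg _) ((abs_nonneg _).trans (hM₁ 0))
    have hb : ‖b q ξ‖ ≤ M₀ * (B * (1 + ξ ^ 2)⁻¹) := by
      rw [norm_smul]
      exact mul_le_mul (hM₀ _) (hB _ hq2 ξ) (norm_nonneg _) ((abs_nonneg _).trans (hM₀ 0))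
    refine (norm_add_le _ _).trans ?_
    rw [ContinuousLinearMap.norm_smulRight_apply, ContinuousLinearMap.norm_smulRight_apply, norm_neg]
    have h1 := mul_le_of_le_one_left (norm_nonneg (a q ξ)) (ContinuousLinearMap.norm_fst_le ℝ ℝ ℝ)
    have h2 := mul_le_of_le_one_left (norm_nonneg (b q ξ)) (ContinuousLinearMap.norm_snd_le ℝ ℝ ℝ)
    linarith
  · have h1 : HasFDerivAt (fun q : ℝ × ℝ ↦ H (q.1 * (2 * π * ξ) ^ 2))
        (deriv H (q.1 * (2 * π * ξ) ^ 2) • (2 * π * ξ) ^ 2 • ContinuousLinearMap.fst ℝ ℝ ℝ) q :=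
      (hH.1.differentiable (by simp) _).hasDerivAt.comp_hasFDerivAt q
        ((ContinuousLinearMap.fst ℝ ℝ ℝ).hasFDerivAt.mul_const _)
    have h2 : HasFDerivAt (fun q : ℝ × ℝ ↦ fiberFourier F ξ q.2)
        ((ContinuousLinearMap.snd ℝ ℝ ℝ).smulRight (fiberFourier Fy ξ q.2)) q := by
      convert! (hF.hasDerivAt_fiberFourier ξ q.2).hasFDerivAt.comp q
        (ContinuousLinearMap.snd ℝ ℝ ℝ).hasFDerivAt using 1
    convert! h1.smul h2 using 1
    have h3 := hF.sq_mul_fiberFourier ξ q.2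
    rw [eq_neg_iff_add_eq_zero, add_comm, ← eq_neg_iff_add_eq_zero] at h3
    ext
    · simp only [L, a, b, hFxx_def, h3]
      simp
      ring
    · simp [L, a, b]

lemma contDiff_profileIntegral {H : ℝ → ℝ} {F : ℝ × ℝ → ℂ} (hH : BoundedDerivs H)
    (hF : FiberCompact F) : ContDiff ℝ ∞ (profileIntegral H F) := by
  rw [contDiff_infty]
  intro n
  induction n generalizing H F with
  | zero =>
    exact contDiff_zero.2 (continuous_iff_continuousAt.2 fun p ↦
      (hasFDerivAt_profileIntegral hH hF p).continuousAt)
  | succ n ih =>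
    refine contDiff_succ_iff_hasFDerivAt.2 ⟨_, ?_, hasFDerivAt_profileIntegral hH hF⟩
    exact (contDiff_const.smulRight
      (ih hH.deriv ((hF.fderiv_apply (1, 0)).fderiv_apply (1, 0))).neg).add
      (contDiff_const.smulRight (ih hH (hF.fderiv_apply (0, 1))))

/-- Fourier inversion for functions that are odd in the first variable. -/
lemma eq_mul_profileIntegral {H : ℝ → ℝ} {F : ℝ × ℝ → ℂ} (hF : FiberCompact F)
    (hsin : ∀ w : ℝ, w * H (w ^ 2) = sin w) (hodd : ∀ x y, F (-x, y) = -F (x, y)) (x y : ℝ) :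
    F (x, y) = x * profileIntegral H (fun p ↦ fderiv ℝ F p (1, 0)) (x ^ 2, y) := by
  have hinv (t : ℝ) : F (t, y) = ∫ ξ, 𝐞 (ξ * t) • fiberFourier F ξ y := by
    have h := (hF.continuous_fiber y).fourierInv_fourier_eq (hF.integrable_fiber y)
      (hF.integrable_fiberFourier y)
    rw [← congrFun h t, Real.fourierInv_eq]
    simp [fiberFourier, mul_comm]
  have hint (t : ℝ) : Integrable fun ξ ↦ 𝐞 (ξ * t) • fiberFourier F ξ y := by
    have := (Real.fourierIntegral_convergent_iff (-t)).2 (hF.integrable_fiberFourier y)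
    simpa [mul_comm] using this
  have h : 2 * F (x, y) = ∫ ξ, (𝐞 (ξ * x) • fiberFourier F ξ y -
      𝐞 (ξ * -x) • fiberFourier F ξ y) := by
    rw [integral_sub (hint x) (hint (-x)), ← hinv, ← hinv, hodd]
    ring
  have h' : 2 * F (x, y) = ∫ ξ, 2 * (x * H (x ^ 2 * (2 * π * ξ) ^ 2) •
      fiberFourier (fun p ↦ fderiv ℝ F p (1, 0)) ξ y) := by
    rw [h]
    congr 1 with ξ
    have hs := congrArg (fun r : ℝ ↦ (r : ℂ)) (hsin (2 * π * (ξ * x)))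
    have hsq : (2 * π * (ξ * x)) ^ 2 = x ^ 2 * (2 * π * ξ) ^ 2 := by ring
    have hexp := Complex.two_sin (2 * π * (ξ * x) : ℝ)
    rw [hsq] at hs
    push_cast at hs hexp
    rw [hF.fiberFourier_fderiv_fst, Circle.smul_def, Circle.smul_def, Real.fourierChar_apply,
      Real.fourierChar_apply, Complex.real_smul, smul_eq_mul, smul_eq_mul]
    have hneg : ((2 * π * (ξ * -x) : ℝ) : ℂ) * Complex.I = -(2 * π * (ξ * x)) * Complex.I := by
      push_cast
      ring
    rw [hneg]
    push_cast
    linear_combination (-Complex.I * fiberFourier F ξ y) * hexp -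
      2 * Complex.I * fiberFourier F ξ y * hs +
      fiberFourier F ξ y * (Complex.exp (2 * π * (ξ * x) * Complex.I) -
        Complex.exp (-(2 * π * (ξ * x)) * Complex.I)) * Complex.I_sq
  rw [integral_const_mul, integral_const_mul] at h'
  exact mul_left_cancel₀ two_ne_zero h'

/-- A smooth function of two variables that is odd in the first one is of the form
`(u, v) ↦ u * G (u ^ 2, v)` with `G` smooth. -/
lemma exists_contDiff_eq_mul_comp_sq {γ : ℝ × ℝ → ℝ} (hγ : ContDiff ℝ ∞ γ)
    (hodd : ∀ u v, γ (-u, v) = -γ (u, v)) :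
    ∃ G : ℝ × ℝ → ℝ, ContDiff ℝ ∞ G ∧ ∀ u v, γ (u, v) = u * G (u ^ 2, v) := by
  obtain ⟨H, hH, hsin⟩ := exists_boundedDerivs_sin_sq
  let χ : ContDiffBump (0 : ℝ) := ⟨1, 2, one_pos, one_lt_two⟩
  let F : ℝ × ℝ → ℂ := fun p ↦ (χ p.1 * γ p : ℝ)
  have hF : FiberCompact F := by
    refine ⟨Complex.ofRealCLM.contDiff.comp ((χ.contDiff.comp contDiff_fst).mul hγ), 2,
      fun x y hx ↦ ?_⟩
    simp [F, χ.zero_of_le_dist (x := x) (by simpa [χ] using hx.le)]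
  have hFodd (x y : ℝ) : F (-x, y) = -F (x, y) := by simp [F, χ.neg, hodd]
  let G₁ : ℝ × ℝ → ℝ := fun p ↦ (profileIntegral H (fun q ↦ fderiv ℝ F q (1, 0)) p).re
  let G₂ : ℝ × ℝ → ℝ := fun p ↦ (1 - χ (√p.1)) * γ (√p.1, p.2) / √p.1
  have hG₁ : ContDiff ℝ ∞ G₁ :=
    Complex.reCLM.contDiff.comp (contDiff_profileIntegral hH (hF.fderiv_apply (1, 0)))
  have hG₂ : ContDiff ℝ ∞ G₂ := by
    refine contDiff_iff_contDiffAt.2 fun p ↦ ?_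
    rcases lt_or_ge p.1 1 with hp | hp
    · refine (contDiffAt_const (c := (0 : ℝ))).congr_of_eventuallyEq ?_
      filter_upwards [continuous_fst.continuousAt.eventually (gt_mem_nhds hp)] with q hq
      have : χ (√q.1) = 1 := χ.one_of_mem_closedBall <| by
        simpa [χ, abs_of_nonneg (sqrt_nonneg _)] using Real.sqrt_le_one.2 (le_of_lt hq)
      simp [G₂, this]
    · have hp0 : 0 < p.1 := zero_lt_one.trans_le hp
      have hs : ContDiffAt ℝ ∞ (fun q : ℝ × ℝ ↦ √q.1) p := contDiffAt_fst.sqrt hp0.ne'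
      exact ((contDiffAt_const.sub (χ.contDiff.contDiffAt.comp p hs)).mul
        (hγ.contDiffAt.comp p (hs.prodMk contDiffAt_snd))).div hs (Real.sqrt_pos.2 hp0).ne'
  refine ⟨fun p ↦ G₁ p + G₂ p, hG₁.add hG₂, fun u v ↦ ?_⟩
  have h₁ : χ u * γ (u, v) = u * G₁ (u ^ 2, v) := by
    have h := congrArg Complex.re (eq_mul_profileIntegral hF hsin hFodd u v)
    simpa [F, G₁] using h
  have h₂ : (1 - χ u) * γ (u, v) = u * G₂ (u ^ 2, v) := by
    simp only [G₂, Real.sqrt_sq_eq_abs]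
    rcases eq_or_ne u 0 with rfl | hu
    · have := hodd 0 v
      rw [neg_zero] at this
      simp [self_eq_neg.1 this]
    · rcases abs_choice u with h | h <;> rw [h]
      · field_simp
      · rw [χ.neg, hodd]
        field_simp
  linear_combination h₁ + h₂

/-- Two-variable Whitney-type factorization: a smooth function odd in each
variable separately factors as `γ̃(u,v) = u·v·K(u², v²)` with `K` smooth. -/
theorem stmt_10 (γ : ℝ × ℝ → ℝ) (hγ : ContDiff ℝ (⊤ : ℕ∞) γ)
    (hodd₁ : ∀ u v : ℝ, γ (-u, v) = -γ (u, v))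
    (hodd₂ : ∀ u v : ℝ, γ (u, -v) = -γ (u, v)) :
    ∃ K : ℝ × ℝ → ℝ, ContDiff ℝ (⊤ : ℕ∞) K ∧
      ∀ u v : ℝ, γ (u, v) = u * v * K (u ^ 2, v ^ 2) := by
  obtain ⟨G, hG, hγG⟩ := exists_contDiff_eq_mul_comp_sq hγ hodd₁
  let G' : ℝ × ℝ → ℝ := fun p ↦ (G (p.2, p.1) - G (p.2, -p.1)) / 2
  have hG' : ContDiff ℝ ∞ G' :=
    ((hG.comp (contDiff_snd.prodMk contDiff_fst)).sub
      (hG.comp (contDiff_snd.prodMk contDiff_fst.neg))).div_const 2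
  obtain ⟨K, hK, hGK⟩ := exists_contDiff_eq_mul_comp_sq hG' fun v s ↦ by
    simp only [G', neg_neg]
    ring
  refine ⟨fun p ↦ K (p.2, p.1), hK.comp (contDiff_snd.prodMk contDiff_fst), fun u v ↦ ?_⟩
  have h₁ := hγG u v
  have h₂ := hγG u (-v)
  have h₃ := hGK v (u ^ 2)
  simp only [G'] at h₃
  rw [hodd₂] at h₂
  linear_combination h₁ / 2 - h₂ / 2 + u * h₃
end

section
/- Let α̃ : ℝ² → ℝ be a smooth function that is even in each variable separately, i.e., α̃(-u,v) = α̃(u,v) and α̃(u,-v) = α̃(u,v). Then there exists a smooth function K : ℝ² → ℝ such that α̃(u,v) = K(u², v²) for all (u,v). -/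
open MeasureTheory Filter Topology
open scoped ContDiff Nat

/-- The entire function `x ↦ ∑ (-x)ⁿ / (2n)!`, equal to `cos √x` for `x ≥ 0`. -/
noncomputable def cosSqrt : ℝ → ℝ :=
  FormalMultilinearSeries.ofScalarsSum fun n : ℕ ↦ (-1 : ℝ) ^ n / ((2 * n)! : ℝ)

theorem cosSqrt_sq (u : ℝ) : cosSqrt (u ^ 2) = Real.cos u := by
  rw [cosSqrt, FormalMultilinearSeries.ofScalars_sum_eq, Real.cos_eq_tsum]
  refine tsum_congr fun n ↦ ?_
  rw [smul_eq_mul, ← pow_mul]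
  ring

theorem contDiff_cosSqrt : ContDiff ℝ ∞ cosSqrt := by
  have hr : (FormalMultilinearSeries.ofScalars ℝ
      fun n : ℕ ↦ (-1 : ℝ) ^ n / ((2 * n)! : ℝ)).radius = ⊤ := by
    refine FormalMultilinearSeries.ofScalars_radius_eq_top_of_tendsto ℝ _
      (Eventually.of_forall fun n ↦ by positivity) ?_
    refine squeeze_zero (fun n ↦ by positivity) (fun n ↦ ?_)
      (tendsto_one_div_add_atTop_nhds_zero_nat (𝕜 := ℝ))
    have h : (2 * n.succ)! = (2 * n + 2) * ((2 * n + 1) * (2 * n)!) := by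
      rw [Nat.mul_succ, Nat.factorial_succ, Nat.factorial_succ]
    have hpos : (0 : ℝ) < ((2 * n)! : ℝ) := by positivity
    simp only [norm_div, norm_pow, norm_neg, norm_one, one_pow, RCLike.norm_natCast, h]
    push_cast
    rw [div_div_eq_mul_div, div_mul_eq_mul_div, div_div, div_le_div_iff₀ (by positivity)
      (by positivity)]
    have : (0 : ℝ) ≤ n := by positivity
    nlinarith [mul_nonneg hpos.le this, mul_nonneg (mul_nonneg hpos.le this) this]
  have h := FormalMultilinearSeries.hasFPowerSeriesOnBall _ (hr ▸ ENNReal.zero_lt_top)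
  rw [hr] at h
  have ha : AnalyticOnNhd ℝ cosSqrt Set.univ := by
    rw [← Metric.eball_top (0 : ℝ)]
    exact h.analyticOnNhd
  exact ha.contDiff

theorem hasDerivAt_comp_sq {G : ℝ → ℝ} (hG : Differentiable ℝ G) (u : ℝ) :
    HasDerivAt (fun u ↦ G (u ^ 2)) (deriv G (u ^ 2) * (2 * u)) u := by
  refine ((hG (u ^ 2)).hasDerivAt.comp u (hasDerivAt_pow 2 u)).congr_deriv ?_
  simp

theorem deriv_cosSqrt_sq (u : ℝ) : deriv cosSqrt (u ^ 2) * (2 * u) = -Real.sin u := by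
  have h := hasDerivAt_comp_sq (contDiff_cosSqrt.differentiable (by simp)) u
  simp only [cosSqrt_sq] at h
  exact h.unique (Real.hasDerivAt_cos u)

theorem cosSqrt_ode {x : ℝ} (hx : 0 < x) (k : ℕ) :
    4 * x * iteratedDeriv (k + 2) cosSqrt x + (4 * k + 2) * iteratedDeriv (k + 1) cosSqrt x
      + iteratedDeriv k cosSqrt x = 0 := by
  have hd (j : ℕ) (x : ℝ) :
      HasDerivAt (iteratedDeriv j cosSqrt) (iteratedDeriv (j + 1) cosSqrt x) x := by
    rw [iteratedDeriv_succ]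
    exact (contDiff_cosSqrt.differentiable_iteratedDeriv j
      (by exact_mod_cast ENat.natCast_lt_top j) x).hasDerivAt
  induction k generalizing x with
  | zero =>
    obtain ⟨u, hu, rfl⟩ : ∃ u, 0 < u ∧ u ^ 2 = x := ⟨√x, by positivity, Real.sq_sqrt hx.le⟩
    have hD : Differentiable ℝ (deriv cosSqrt) := by
      simpa using contDiff_cosSqrt.differentiable_iteratedDeriv 1 (by simp)
    have h := (hasDerivAt_comp_sq hD u).mul ((hasDerivAt_id u).const_mul 2)
    have h' := h.unique ((Real.hasDerivAt_sin u).neg.congr_of_eventuallyEq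
      (Eventually.of_forall deriv_cosSqrt_sq))
    simp only [iteratedDeriv_succ, iteratedDeriv_zero, Nat.cast_zero, cosSqrt_sq, zero_add]
    simp only [id] at h'
    linarith
  | succ k ih =>
    have h := ((((hasDerivAt_id x).const_mul 4).mul (hd (k + 2) x)).add
      ((hd (k + 1) x).const_mul (4 * k + 2 : ℝ))).add (hd k x)
    have h0 := h.unique ((hasDerivAt_const x (0 : ℝ)).congr_of_eventuallyEq
      ((eventually_gt_nhds hx).mono fun y hy ↦ ih hy))
    simp only [id] at h0
    push_cast
    linarith

theorem bounded_iteratedDeriv_cosSqrt (k : ℕ) :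
    ∃ M, ∀ x, 1 ≤ x → |iteratedDeriv k cosSqrt x| ≤ M := by
  induction k using Nat.strong_induction_on with
  | _ k ih =>
    match k with
    | 0 =>
      refine ⟨1, fun x hx ↦ ?_⟩
      rw [iteratedDeriv_zero, ← Real.sq_sqrt (zero_le_one.trans hx), cosSqrt_sq]
      exact Real.abs_cos_le_one _
    | 1 =>
      refine ⟨1, fun x hx ↦ ?_⟩
      have h := deriv_cosSqrt_sq √x
      have h1 := Real.one_le_sqrt.2 hx
      rw [Real.sq_sqrt (zero_le_one.trans hx)] at h
      have h2 := Real.abs_sin_le_one √x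
      rw [← abs_neg, ← h, abs_mul, abs_of_nonneg (by positivity : 0 ≤ 2 * √x)] at h2
      rw [iteratedDeriv_one]
      nlinarith [abs_nonneg (deriv cosSqrt x)]
    | k + 2 =>
      obtain ⟨M, hM⟩ := ih k (by lia)
      obtain ⟨N, hN⟩ := ih (k + 1) (by lia)
      refine ⟨(4 * k + 2) * N + M, fun x hx ↦ ?_⟩
      have h := cosSqrt_ode (zero_lt_one.trans_le hx) k
      have hk : (0 : ℝ) ≤ 4 * k + 2 := by positivity
      have h1 : 4 * x * |iteratedDeriv (k + 2) cosSqrt x| ≤ (4 * k + 2) * N + M := by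
        rw [← abs_of_nonneg (by positivity : 0 ≤ 4 * x), ← abs_mul,
          show 4 * x * iteratedDeriv (k + 2) cosSqrt x = -((4 * k + 2) *
            iteratedDeriv (k + 1) cosSqrt x + iteratedDeriv k cosSqrt x) by linarith, abs_neg]
        refine (abs_add_le _ _).trans (add_le_add ?_ (hM x hx))
        rw [abs_mul, abs_of_nonneg hk]
        exact mul_le_mul_of_nonneg_left (hN x hx) hk
      nlinarith [abs_nonneg (iteratedDeriv (k + 2) cosSqrt x)]

/-- A smooth function on the line all of whose derivatives are bounded. -/
def SmoothBounded (A : ℝ → ℝ) : Prop :=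
  ContDiff ℝ ∞ A ∧ ∀ k, ∃ M, ∀ x, |iteratedDeriv k A x| ≤ M

theorem SmoothBounded.deriv {A : ℝ → ℝ} (hA : SmoothBounded A) : SmoothBounded (deriv A) :=
  ⟨(contDiff_infty_iff_deriv.1 hA.1).2, fun k ↦ by
    simpa only [iteratedDeriv_succ'] using hA.2 (k + 1)⟩

theorem exists_smoothBounded_sq_eq_cos :
    ∃ C : ℝ → ℝ, SmoothBounded C ∧ ∀ u, C (u ^ 2) = Real.cos u := by
  have hs : ContDiff ℝ ∞ fun x ↦ Real.smoothTransition (x + 1) * cosSqrt x :=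
    (Real.smoothTransition.contDiff.comp (contDiff_id.add contDiff_const)).mul contDiff_cosSqrt
  have heq {x : ℝ} (hx : 0 ≤ x) : Real.smoothTransition (x + 1) * cosSqrt x = cosSqrt x := by
    rw [Real.smoothTransition.one_of_one_le (by linarith), one_mul]
  refine ⟨fun x ↦ Real.smoothTransition (x + 1) * cosSqrt x, ⟨hs, fun k ↦ ?_⟩, fun u ↦ ?_⟩
  · obtain ⟨M, hM⟩ := bounded_iteratedDeriv_cosSqrt k
    obtain ⟨N, hN⟩ := (isCompact_Icc (a := (-2 : ℝ)) (b := 1)).exists_bound_of_continuousOn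
      (hs.continuous_iteratedDeriv k (by exact_mod_cast le_top)).continuousOn
    refine ⟨max M (max N 0), fun x ↦ ?_⟩
    rcases lt_or_ge x (-2) with h | h
    · have : (fun x ↦ Real.smoothTransition (x + 1) * cosSqrt x) =ᶠ[𝓝 x] fun _ ↦ 0 := by
        filter_upwards [eventually_lt_nhds h] with y hy
        rw [Real.smoothTransition.zero_of_nonpos (by linarith), zero_mul]
      rw [this.iteratedDeriv_eq k]
      simp
    rcases le_or_gt x 1 with h' | h'
    · exact (hN x ⟨h, h'⟩).trans ((le_max_left _ _).trans (le_max_right _ _))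
    · have : (fun x ↦ Real.smoothTransition (x + 1) * cosSqrt x) =ᶠ[𝓝 x] cosSqrt := by
        filter_upwards [eventually_gt_nhds h'] with y hy
        exact heq (by linarith)
      rw [this.iteratedDeriv_eq k]
      exact (hM x h'.le).trans (le_max_left _ _)
  · exact (heq (sq_nonneg u)).trans (cosSqrt_sq u)

section ParametricIntegral

variable {Ω : Type*} [MeasurableSpace Ω] {μ : Measure Ω} {a b F : Ω → ℝ} {A B : ℝ → ℝ}

theorem SmoothBounded.integrable_mul_mul (ha : AEStronglyMeasurable a μ)
    (hb : AEStronglyMeasurable b μ) (hF : Integrable F μ) (hA : SmoothBounded A)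
    (hB : SmoothBounded B) (p : ℝ × ℝ) :
    Integrable (fun w ↦ A (a w * p.1) * B (b w * p.2) * F w) μ := by
  obtain ⟨M, hM⟩ := hA.2 0
  obtain ⟨N, hN⟩ := hB.2 0
  refine hF.bdd_mul (c := M * N) ?_ (Eventually.of_forall fun w ↦ ?_)
  · exact (hA.1.continuous.comp_aestronglyMeasurable (ha.mul_const _)).mul
      (hB.1.continuous.comp_aestronglyMeasurable (hb.mul_const _))
  · rw [norm_mul]
    exact mul_le_mul (hM _) (hN _) (norm_nonneg _) ((abs_nonneg _).trans (hM 0))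

theorem hasFDerivAt_comp_mul_comp_mul (hA : Differentiable ℝ A) (hB : Differentiable ℝ B)
    (r s c : ℝ) (p : ℝ × ℝ) :
    HasFDerivAt (fun p : ℝ × ℝ ↦ A (r * p.1) * B (s * p.2) * c)
      ((deriv A (r * p.1) * B (s * p.2) * (r * c)) • ContinuousLinearMap.fst ℝ ℝ ℝ +
        (A (r * p.1) * deriv B (s * p.2) * (s * c)) • ContinuousLinearMap.snd ℝ ℝ ℝ) p := by
  have hA' : HasFDerivAt (fun p : ℝ × ℝ ↦ A (r * p.1))
      (deriv A (r * p.1) • r • ContinuousLinearMap.fst ℝ ℝ ℝ) p :=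
    (hA (r * p.1)).hasDerivAt.comp_hasFDerivAt p (hasFDerivAt_fst.const_mul r)
  have hB' : HasFDerivAt (fun p : ℝ × ℝ ↦ B (s * p.2))
      (deriv B (s * p.2) • s • ContinuousLinearMap.snd ℝ ℝ ℝ) p :=
    (hB (s * p.2)).hasDerivAt.comp_hasFDerivAt p (hasFDerivAt_snd.const_mul s)
  refine ((hA'.mul hB').mul_const c).congr_fderiv ?_
  module

theorem SmoothBounded.hasFDerivAt_integral (ha : AEStronglyMeasurable a μ)
    (hb : AEStronglyMeasurable b μ) (hF : Integrable F μ)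
    (hFa : Integrable (fun w ↦ a w * F w) μ) (hFb : Integrable (fun w ↦ b w * F w) μ)
    (hA : SmoothBounded A) (hB : SmoothBounded B) (p : ℝ × ℝ) :
    HasFDerivAt (fun p : ℝ × ℝ ↦ ∫ w, A (a w * p.1) * B (b w * p.2) * F w ∂μ)
      ((∫ w, _root_.deriv A (a w * p.1) * B (b w * p.2) * (a w * F w) ∂μ) •
          ContinuousLinearMap.fst ℝ ℝ ℝ +
        (∫ w, A (a w * p.1) * _root_.deriv B (b w * p.2) * (b w * F w) ∂μ) •
          ContinuousLinearMap.snd ℝ ℝ ℝ) p := by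
  have h1 := (integrable_mul_mul ha hb hFa hA.deriv hB p).smul_const
    (ContinuousLinearMap.fst ℝ ℝ ℝ)
  have h2 := (integrable_mul_mul ha hb hFb hA hB.deriv p).smul_const
    (ContinuousLinearMap.snd ℝ ℝ ℝ)
  obtain ⟨M, hM⟩ := hA.2 0
  obtain ⟨N, hN⟩ := hB.2 0
  obtain ⟨M', hM'⟩ := hA.deriv.2 0
  obtain ⟨N', hN'⟩ := hB.deriv.2 0
  simp only [iteratedDeriv_zero] at hM hN hM' hN'
  have hM0 := (abs_nonneg _).trans (hM 0)
  have hM0' := (abs_nonneg _).trans (hM' 0)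
  have hbound (w : Ω) (p : ℝ × ℝ) :
      ‖(_root_.deriv A (a w * p.1) * B (b w * p.2) * (a w * F w)) •
          ContinuousLinearMap.fst ℝ ℝ ℝ +
        (A (a w * p.1) * _root_.deriv B (b w * p.2) * (b w * F w)) •
          ContinuousLinearMap.snd ℝ ℝ ℝ‖ ≤ M' * N * ‖a w * F w‖ + M * N' * ‖b w * F w‖ := by
    refine (norm_add_le _ _).trans (add_le_add ?_ ?_)
    · rw [norm_smul]
      refine (mul_le_of_le_one_right (norm_nonneg _)
        (ContinuousLinearMap.norm_fst_le ℝ ℝ ℝ)).trans ?_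
      rw [norm_mul, norm_mul]
      exact mul_le_mul_of_nonneg_right
        (mul_le_mul (hM' _) (hN _) (norm_nonneg _) hM0') (norm_nonneg _)
    · rw [norm_smul]
      refine (mul_le_of_le_one_right (norm_nonneg _)
        (ContinuousLinearMap.norm_snd_le ℝ ℝ ℝ)).trans ?_
      rw [norm_mul, norm_mul]
      exact mul_le_mul_of_nonneg_right
        (mul_le_mul (hM _) (hN' _) (norm_nonneg _) hM0) (norm_nonneg _)
  have h := hasFDerivAt_integral_of_dominated_of_fderiv_le univ_mem
    (Eventually.of_forall fun p ↦ (integrable_mul_mul ha hb hF hA hB p).aestronglyMeasurable)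
    (integrable_mul_mul ha hb hF hA hB p) (h1.add h2).aestronglyMeasurable
    (Eventually.of_forall fun w p _ ↦ hbound w p)
    ((hFa.norm.const_mul _).add (hFb.norm.const_mul _))
    (Eventually.of_forall fun w p _ ↦ hasFDerivAt_comp_mul_comp_mul
      (hA.1.differentiable (by simp)) (hB.1.differentiable (by simp)) (a w) (b w) (F w) p)
  refine h.congr_fderiv ((integral_add h1 h2).trans ?_)
  rw [integral_smul_const, integral_smul_const]

theorem SmoothBounded.contDiff_integral (ha : AEStronglyMeasurable a μ)
    (hb : AEStronglyMeasurable b μ) (n : ℕ)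
    (hF : ∀ i j : ℕ, Integrable (fun w ↦ a w ^ i * b w ^ j * F w) μ)
    (hA : SmoothBounded A) (hB : SmoothBounded B) :
    ContDiff ℝ n fun p : ℝ × ℝ ↦ ∫ w, A (a w * p.1) * B (b w * p.2) * F w ∂μ := by
  induction n generalizing F A B with
  | zero =>
    have hderiv := hA.hasFDerivAt_integral ha hb (by simpa using hF 0 0) (by simpa using hF 1 0)
      (by simpa using hF 0 1) hB
    exact contDiff_zero.2 (continuous_iff_continuousAt.2 fun p ↦ (hderiv p).continuousAt)
  | succ n ih =>
    have hderiv := hA.hasFDerivAt_integral ha hb (by simpa using hF 0 0) (by simpa using hF 1 0)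
      (by simpa using hF 0 1) hB
    have hFa (i j : ℕ) : Integrable (fun w ↦ a w ^ i * b w ^ j * (a w * F w)) μ := by
      convert hF (i + 1) j using 2
      ring
    have hFb (i j : ℕ) : Integrable (fun w ↦ a w ^ i * b w ^ j * (b w * F w)) μ := by
      convert hF i (j + 1) using 2
      ring
    exact_mod_cast contDiff_succ_iff_hasFDerivAt.2
      ⟨_, ((ih hFa hA.deriv hB).smul contDiff_const).add
        ((ih hFb hA hB.deriv).smul contDiff_const), hderiv⟩

end ParametricIntegral

theorem SchwartzMap.integrable_coord_pow_mul_re (F : SchwartzMap (EuclideanSpace ℝ (Fin 2)) ℂ)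
    (i j : ℕ) :
    Integrable fun w : EuclideanSpace ℝ (Fin 2) ↦
      ((2 * Real.pi * w 0) ^ 2) ^ i * ((2 * Real.pi * w 1) ^ 2) ^ j * (F w).re := by
  refine ((F.integrable_pow_mul volume (2 * i + 2 * j)).const_mul
    ((2 * Real.pi) ^ (2 * i + 2 * j))).mono' ?_ (Eventually.of_forall fun w ↦ ?_)
  · have := F.continuous
    exact Continuous.aestronglyMeasurable (by fun_prop)
  · have h0 : ‖w 0‖ ≤ ‖w‖ := PiLp.norm_apply_le w 0
    have h1 : ‖w 1‖ ≤ ‖w‖ := PiLp.norm_apply_le w 1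
    calc ‖((2 * Real.pi * w 0) ^ 2) ^ i * ((2 * Real.pi * w 1) ^ 2) ^ j * (F w).re‖
        = (2 * Real.pi) ^ (2 * i + 2 * j) * (‖w 0‖ ^ (2 * i) * ‖w 1‖ ^ (2 * j) * ‖(F w).re‖) := by
          have h : ‖2 * Real.pi‖ = 2 * Real.pi := Real.norm_of_nonneg (by positivity)
          rw [norm_mul, norm_mul, norm_pow, norm_pow, norm_pow, norm_pow, norm_mul, norm_mul _ (w 1),
            h]
          generalize 2 * Real.pi = c
          ring
      _ ≤ (2 * Real.pi) ^ (2 * i + 2 * j) * (‖w‖ ^ (2 * i) * ‖w‖ ^ (2 * j) * ‖F w‖) := by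
          gcongr
          exact Complex.abs_re_le_norm _
      _ = _ := by rw [← pow_add]

theorem eq_integral_cos_mul_cos {f : ℝ × ℝ → ℝ} (S : SchwartzMap (EuclideanSpace ℝ (Fin 2)) ℂ)
    (hS : ∀ u v : ℝ, S !₂[u, v] = f (u, v)) (h₁ : ∀ u v : ℝ, f (-u, v) = f (u, v))
    (h₂ : ∀ u v : ℝ, f (u, -v) = f (u, v)) (u v : ℝ) :
    f (u, v) = ∫ w : EuclideanSpace ℝ (Fin 2), Real.cos (2 * Real.pi * w 0 * u) *
      Real.cos (2 * Real.pi * w 1 * v) * (FourierTransform.fourier S w).re := by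
  set F := FourierTransform.fourier S with hF
  let e (u v : ℝ) (w : EuclideanSpace ℝ (Fin 2)) : ℂ :=
    Complex.exp (((2 * Real.pi * (w 0 * u + w 1 * v) : ℝ) : ℂ) * Complex.I) * F w
  have hint (u v : ℝ) : Integrable (e u v) := by
    refine F.integrable.bdd_mul (c := 1) ?_ (Eventually.of_forall fun w ↦ ?_)
    · exact Continuous.aestronglyMeasurable (by fun_prop)
    · rw [Complex.norm_exp_ofReal_mul_I]
  have hinv (u v : ℝ) : (f (u, v) : ℂ) = ∫ w, e u v w := by
    rw [← hS, ← FourierTransform.fourierInv_fourier_eq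
      (F := SchwartzMap (EuclideanSpace ℝ (Fin 2)) ℂ) S, ← hF, SchwartzMap.fourierInv_coe,
      Real.fourierInv_eq']
    refine integral_congr_ae (Eventually.of_forall fun w ↦ ?_)
    simp [e, PiLp.inner_apply, Fin.sum_univ_two, mul_comm]
  have hsum : (f (u, v) : ℂ) = ∫ w, (1 / 4 : ℂ) * (e u v w + e (-u) v w +
      (e u (-v) w + e (-u) (-v) w)) := by
    have hint₂ (x y x' y' : ℝ) : Integrable fun w ↦ e x y w + e x' y' w :=
      (hint x y).add (hint x' y')
    rw [integral_const_mul, integral_add (hint₂ _ _ _ _) (hint₂ _ _ _ _),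
      integral_add (hint _ _) (hint _ _), integral_add (hint _ _) (hint _ _), ← hinv, ← hinv,
      ← hinv, ← hinv]
    simp only [h₁, h₂]
    ring
  have hcos (w : EuclideanSpace ℝ (Fin 2)) : (1 / 4 : ℂ) * (e u v w + e (-u) v w +
      (e u (-v) w + e (-u) (-v) w)) = ((Real.cos (2 * Real.pi * w 0 * u) *
        Real.cos (2 * Real.pi * w 1 * v) : ℝ) : ℂ) * F w := by
    have hexp (x y : ℝ) : Complex.exp (((2 * Real.pi * (w 0 * x + w 1 * y) : ℝ) : ℂ) * Complex.I)
        = Complex.exp ((2 * Real.pi * w 0 * x : ℝ) * Complex.I) *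
          Complex.exp ((2 * Real.pi * w 1 * y : ℝ) * Complex.I) := by
      rw [← Complex.exp_add]
      push_cast
      ring_nf
    simp only [e, hexp]
    simp only [Complex.ofReal_mul, Complex.ofReal_cos, Complex.cos]
    push_cast
    simp only [mul_neg, neg_mul]
    ring
  simp only [hcos] at hsum
  have hi : Integrable fun w ↦ ((Real.cos (2 * Real.pi * w 0 * u) *
      Real.cos (2 * Real.pi * w 1 * v) : ℝ) : ℂ) * F w := by
    simp only [← hcos]
    exact (((hint _ _).add (hint _ _)).add ((hint _ _).add (hint _ _))).const_mul _
  have h := congrArg Complex.re hsum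
  rw [Complex.ofReal_re] at h
  rw [h, ← RCLike.re_eq_complex_re, ← integral_re hi]
  simp only [RCLike.re_eq_complex_re, Complex.re_ofReal_mul]

/-- Whitney's theorem for compactly supported functions. -/
theorem HasCompactSupport.exists_contDiff_comp_sq {f : ℝ × ℝ → ℝ} (hc : HasCompactSupport f)
    (hf : ContDiff ℝ ∞ f) (h₁ : ∀ u v : ℝ, f (-u, v) = f (u, v))
    (h₂ : ∀ u v : ℝ, f (u, -v) = f (u, v)) :
    ∃ K : ℝ × ℝ → ℝ, ContDiff ℝ ∞ K ∧ ∀ u v : ℝ, f (u, v) = K (u ^ 2, v ^ 2) := by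
  let L : EuclideanSpace ℝ (Fin 2) ≃L[ℝ] ℝ × ℝ :=
    (EuclideanSpace.equiv (Fin 2) ℝ).trans (ContinuousLinearEquiv.finTwoArrow ℝ ℝ)
  have hcL : HasCompactSupport fun z ↦ ((f (L z) : ℝ) : ℂ) :=
    (hc.comp_homeomorph L.toHomeomorph).comp_left Complex.ofReal_zero
  let S := hcL.toSchwartzMap (Complex.ofRealCLM.contDiff.comp (hf.comp L.contDiff))
  obtain ⟨C, hC, hcos⟩ := exists_smoothBounded_sq_eq_cos
  let F := FourierTransform.fourier S
  refine ⟨fun p ↦ ∫ w : EuclideanSpace ℝ (Fin 2), C ((2 * Real.pi * w 0) ^ 2 * p.1) *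
    C ((2 * Real.pi * w 1) ^ 2 * p.2) * (F w).re, contDiff_infty.2 fun n ↦
      hC.contDiff_integral
        (Continuous.aestronglyMeasurable (by fun_prop))
        (Continuous.aestronglyMeasurable (by fun_prop)) n F.integrable_coord_pow_mul_re hC,
    fun u v ↦ ?_⟩
  rw [eq_integral_cos_mul_cos S (fun u v ↦ rfl) h₁ h₂ u v]
  simp only [← mul_pow, hcos, F]

theorem exists_contDiff_comp_sq_near {f : ℝ × ℝ → ℝ} (hf : ContDiff ℝ ∞ f)
    (h₁ : ∀ u v : ℝ, f (-u, v) = f (u, v)) (h₂ : ∀ u v : ℝ, f (u, -v) = f (u, v)) (p : ℝ × ℝ) :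
    ∃ U ∈ 𝓝 p, ∃ K : ℝ × ℝ → ℝ, ContDiff ℝ ∞ K ∧
      ∀ u v : ℝ, (u ^ 2, v ^ 2) ∈ U → f (u, v) = K (u ^ 2, v ^ 2) := by
  let χ : ContDiffBump p := ⟨1, 2, zero_lt_one, one_lt_two⟩
  have hs : ContDiff ℝ ∞ fun q : ℝ × ℝ ↦ χ (q.1 ^ 2, q.2 ^ 2) * f q :=
    (χ.contDiff.comp ((contDiff_fst.pow 2).prodMk (contDiff_snd.pow 2))).mul hf
  have hc : HasCompactSupport fun q : ℝ × ℝ ↦ χ (q.1 ^ 2, q.2 ^ 2) * f q := by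
    refine HasCompactSupport.intro (isCompact_closedBall 0 (‖p‖ + 3)) fun q hq ↦ ?_
    rw [χ.zero_of_le_dist, zero_mul]
    rw [mem_closedBall_zero_iff, not_le] at hq
    have hnorm : ‖q‖ ≤ ‖((q.1 ^ 2, q.2 ^ 2) : ℝ × ℝ)‖ + 1 := by
      rw [Prod.norm_def, Prod.norm_def, norm_pow, norm_pow]
      refine max_le ?_ ?_
      · nlinarith [le_max_left (‖q.1‖ ^ 2) (‖q.2‖ ^ 2), sq_nonneg (‖q.1‖ - 1)]
      · nlinarith [le_max_right (‖q.1‖ ^ 2) (‖q.2‖ ^ 2), sq_nonneg (‖q.2‖ - 1)]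
    have := norm_sub_norm_le ((q.1 ^ 2, q.2 ^ 2) : ℝ × ℝ) p
    rw [dist_eq_norm]
    change (2 : ℝ) ≤ _
    linarith
  obtain ⟨K, hK, hfK⟩ := hc.exists_contDiff_comp_sq hs
    (fun u v ↦ by simp only [neg_sq, h₁]) (fun u v ↦ by simp only [neg_sq, h₂])
  refine ⟨Metric.closedBall p 1, Metric.closedBall_mem_nhds p one_pos, K, hK, fun u v huv ↦ ?_⟩
  rw [← hfK, χ.one_of_mem_closedBall huv, one_mul]

/-- Two-variable Whitney theorem on even functions: a smooth function even in
each variable separately factors as `α̃(u,v) = K(u², v²)` with `K` smooth. -/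
theorem stmt_11 (α : ℝ × ℝ → ℝ) (hα : ContDiff ℝ (⊤ : ℕ∞) α)
    (heven₁ : ∀ u v : ℝ, α (-u, v) = α (u, v))
    (heven₂ : ∀ u v : ℝ, α (u, -v) = α (u, v)) :
    ∃ K : ℝ × ℝ → ℝ, ContDiff ℝ (⊤ : ℕ∞) K ∧
      ∀ u v : ℝ, α (u, v) = K (u ^ 2, v ^ 2) := by
  let t (p : ℝ × ℝ) : Set ℝ := {c | ∀ u v : ℝ, (u ^ 2, v ^ 2) = p → c = α (u, v)}
  have ht (p : ℝ × ℝ) : Convex ℝ (t p) := by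
    intro c hc d hd a b _ _ hab u v huv
    rw [hc u v huv, hd u v huv, smul_eq_mul, smul_eq_mul, ← add_mul, hab, one_mul]
  obtain ⟨g, hg⟩ := exists_contMDiffMap_forall_mem_convex_of_local (n := ⊤)
    (modelWithCornersSelf ℝ (ℝ × ℝ)) ht fun p ↦ by
      obtain ⟨U, hU, K, hK, hαK⟩ := exists_contDiff_comp_sq_near hα heven₁ heven₂ p
      refine ⟨U, hU, K, hK.contMDiff.contMDiffOn, ?_⟩
      rintro _ hy u v rfl
      exact (hαK u v hy).symm
  exact ⟨g, g.contMDiff.contDiff, fun u v ↦ (hg _ u v rfl).symm⟩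
end

section
/- Let γ : (0,∞)² → ℝ be a function such that the map (u,v) ↦ 4·u·v·γ(u², v²), extended by 0 on the coordinate axes, is smooth on ℝ². Then γ extends to a smooth function on all of ℝ² (in particular γ is bounded near the corner, with no singular part). -/
open MeasureTheory Filter Set
open scoped ContDiff Topology FourierTransform SchwartzMap

theorem exists_contDiff_mul_comp_sq_eq_sin :
    ∃ A : ℝ → ℝ, ContDiff ℝ ∞ A ∧ ∀ u, u * A (u ^ 2) = Real.sin u := by
  let c : ℕ → ℝ := fun n ↦ (-1) ^ n / (2 * n + 1).factorial
  have hc : ∀ n, c n ≠ 0 := fun n ↦ by positivity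
  have hlim : Tendsto (fun n ↦ ‖c n.succ‖ / ‖c n‖) atTop (𝓝 0) := by
    refine squeeze_zero (fun n ↦ by positivity) (fun n ↦ ?_) tendsto_one_div_add_atTop_nhds_zero_nat
    have hfac : ((2 * n.succ + 1).factorial : ℝ) =
        (2 * n + 3) * (2 * n + 2) * (2 * n + 1).factorial := by
      rw [show 2 * n.succ + 1 = (2 * n + 1) + 1 + 1 by omega, Nat.factorial_succ,
        Nat.factorial_succ]
      push_cast
      ring
    have hpos : (0 : ℝ) < (2 * n + 1).factorial := by positivity
    simp only [c, norm_div, norm_pow, norm_neg, norm_one, one_pow, Real.norm_natCast]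
    rw [hfac, div_div_eq_mul_div, div_one, one_div, inv_mul_eq_div, div_le_div_iff₀ (by positivity)
      (by positivity)]
    have hn : (0 : ℝ) ≤ n := n.cast_nonneg
    nlinarith [mul_nonneg hn hn, mul_nonneg hpos.le hn, mul_nonneg hpos.le (mul_nonneg hn hn)]
  have hrad := FormalMultilinearSeries.ofScalars_radius_eq_top_of_tendsto ℝ c
    (Eventually.of_forall hc) hlim
  have hps := (FormalMultilinearSeries.ofScalars ℝ c).hasFPowerSeriesOnBall (by simp [hrad])
  rw [hrad] at hps
  refine ⟨(FormalMultilinearSeries.ofScalars ℝ c).sum, ?_, fun u ↦ ?_⟩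
  · rw [← contDiffOn_univ]
    have := hps.analyticOnNhd
    rw [Metric.eball_top] at this
    exact this.contDiffOn uniqueDiffOn_univ
  · have := (hps.hasSum (y := u ^ 2) (by simp)).mul_left u
    rw [zero_add] at this
    refine this.unique ?_
    convert! Real.hasSum_sin u using 2 with n
    simp [c]
    ring

theorem hasDerivAt_iteratedDeriv {A : ℝ → ℝ} (hA : ContDiff ℝ ∞ A) (k : ℕ) (t : ℝ) :
    HasDerivAt (iteratedDeriv k A) (iteratedDeriv (k + 1) A t) t := by
  rw [iteratedDeriv_succ]
  exact ((hA.differentiable_iteratedDeriv k (mod_cast ENat.natCast_lt_top k)) t).hasDerivAt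

theorem hasDerivAt_iteratedDeriv_comp_sq {A : ℝ → ℝ} (hA : ContDiff ℝ ∞ A) (k : ℕ) (u : ℝ) :
    HasDerivAt (fun w ↦ iteratedDeriv k A (w ^ 2))
      (iteratedDeriv (k + 1) A (u ^ 2) * (2 * u)) u := by
  refine (HasDerivAt.comp u (h := fun w : ℝ ↦ w ^ 2) (hasDerivAt_iteratedDeriv hA k (u ^ 2))
    (hasDerivAt_pow 2 u)).congr_deriv ?_
  simp

theorem add_mul_iteratedDeriv_one_eq_cos {A : ℝ → ℝ} (hA : ContDiff ℝ ∞ A)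
    (hsin : ∀ u, u * A (u ^ 2) = Real.sin u) (u : ℝ) :
    A (u ^ 2) + 2 * u ^ 2 * iteratedDeriv 1 A (u ^ 2) = Real.cos u := by
  have h0 := hasDerivAt_iteratedDeriv_comp_sq hA 0 u
  rw [iteratedDeriv_zero] at h0
  have h := (hasDerivAt_id u).mul h0
  have h' := h.unique ((Real.hasDerivAt_sin u).congr_of_eventuallyEq
    (Eventually.of_forall fun w ↦ hsin w))
  simp at h' ⊢
  linarith

theorem iteratedDeriv_recurrence {A : ℝ → ℝ} (hA : ContDiff ℝ ∞ A)
    (hsin : ∀ u, u * A (u ^ 2) = Real.sin u) (k : ℕ) : ∀ t : ℝ, 0 < t →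
    4 * t * iteratedDeriv (k + 2) A t + (4 * k + 6) * iteratedDeriv (k + 1) A t
      + iteratedDeriv k A t = 0 := by
  induction k with
  | zero =>
    intro t ht
    obtain ⟨u, hu, rfl⟩ : ∃ u : ℝ, 0 < u ∧ u ^ 2 = t :=
      ⟨√t, Real.sqrt_pos.2 ht, Real.sq_sqrt ht.le⟩
    have h0 := hasDerivAt_iteratedDeriv_comp_sq hA 0 u
    rw [iteratedDeriv_zero] at h0
    have h := h0.add (((hasDerivAt_pow 2 u).const_mul 2).mul
      (hasDerivAt_iteratedDeriv_comp_sq hA 1 u))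
    have h' := h.unique ((Real.hasDerivAt_cos u).congr_of_eventuallyEq
      (Eventually.of_forall fun w ↦ add_mul_iteratedDeriv_one_eq_cos hA hsin w))
    simp [← hsin u] at h' ⊢
    refine mul_left_cancel₀ hu.ne' ?_
    linear_combination h'
  | succ k ih =>
    intro t ht
    have h := ((((hasDerivAt_id t).const_mul 4).mul (hasDerivAt_iteratedDeriv hA (k + 2) t)).add
      ((hasDerivAt_iteratedDeriv hA (k + 1) t).const_mul (4 * (k : ℝ) + 6))).add
      (hasDerivAt_iteratedDeriv hA k t)
    have h' := h.unique ((hasDerivAt_const t (0 : ℝ)).congr_of_eventuallyEq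
      ((eventually_gt_nhds ht).mono fun s hs ↦ ih s hs))
    simp at h'
    push_cast
    linear_combination h'

theorem exists_abs_iteratedDeriv_le_of_one_le {A : ℝ → ℝ} (hA : ContDiff ℝ ∞ A)
    (hsin : ∀ u, u * A (u ^ 2) = Real.sin u) (k : ℕ) :
    ∃ C, ∀ t : ℝ, 1 ≤ t → |iteratedDeriv k A t| ≤ C := by
  have hsq : ∀ t : ℝ, 1 ≤ t → ∃ u : ℝ, 1 ≤ u ∧ u ^ 2 = t := fun t ht ↦
    ⟨√t, Real.one_le_sqrt.2 ht, Real.sq_sqrt (by linarith)⟩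
  have hA1 : ∀ t : ℝ, 1 ≤ t → |A t| ≤ 1 := by
    intro t ht
    obtain ⟨u, hu, rfl⟩ := hsq t ht
    have h := Real.abs_sin_le_one u
    rw [← hsin u, abs_mul, abs_of_pos (by linarith)] at h
    nlinarith [abs_nonneg (A (u ^ 2))]
  induction k using Nat.strong_induction_on with
  | _ k ih =>
    match k, ih with
    | 0, _ => exact ⟨1, fun t ht ↦ by simpa using hA1 t ht⟩
    | 1, _ =>
      refine ⟨1, fun t ht ↦ ?_⟩
      have h1 := hA1 t ht
      obtain ⟨u, hu, rfl⟩ := hsq t ht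
      have h2 := Real.abs_cos_le_one u
      rw [← add_mul_iteratedDeriv_one_eq_cos hA hsin u] at h2
      rw [abs_le] at *
      constructor <;> nlinarith
    | k + 2, ih =>
      obtain ⟨C, hC⟩ := ih k (by omega)
      obtain ⟨D, hD⟩ := ih (k + 1) (by omega)
      refine ⟨(4 * k + 6) * D + C, fun t ht ↦ ?_⟩
      have hrec := iteratedDeriv_recurrence hA hsin k t (by linarith)
      have hb : |4 * t * iteratedDeriv (k + 2) A t| ≤ (4 * k + 6) * D + C := by
        rw [show 4 * t * iteratedDeriv (k + 2) A t =
          -((4 * k + 6) * iteratedDeriv (k + 1) A t + iteratedDeriv k A t) by linarith, abs_neg]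
        refine (abs_add_le _ _).trans (add_le_add ?_ (hC t ht))
        rw [abs_mul, abs_of_pos (by positivity)]
        gcongr
        exact hD t ht
      rw [abs_mul, abs_of_pos (by linarith)] at hb
      nlinarith [abs_nonneg (iteratedDeriv (k + 2) A t)]

/-- The function `t ↦ sin √t / √t` on the positive half-line is the restriction of a smooth
function on the line all of whose derivatives are bounded. -/
theorem exists_contDiff_bounded_mul_comp_sq_eq_sin :
    ∃ S : ℝ → ℝ, ContDiff ℝ ∞ S ∧ (∀ k, ∃ C, ∀ t, |iteratedDeriv k S t| ≤ C) ∧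
      ∀ u, u * S (u ^ 2) = Real.sin u := by
  obtain ⟨A, hA, hsin⟩ := exists_contDiff_mul_comp_sq_eq_sin
  have hcut : ContDiff ℝ ∞ fun t : ℝ ↦ Real.smoothTransition (t + 1) :=
    Real.smoothTransition.contDiff.comp (contDiff_id.add contDiff_const)
  have hS : ContDiff ℝ ∞ fun t : ℝ ↦ Real.smoothTransition (t + 1) * A t := hcut.mul hA
  refine ⟨_, hS, fun k ↦ ?_, fun u ↦ ?_⟩
  · obtain ⟨C, hC⟩ := exists_abs_iteratedDeriv_le_of_one_le hA hsin k
    obtain ⟨D, hD⟩ := (isCompact_Icc (a := (-2 : ℝ)) (b := 1)).exists_bound_of_continuousOn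
      (hS.continuous_iteratedDeriv k (mod_cast le_top)).continuousOn
    refine ⟨max C D, fun t ↦ ?_⟩
    rcases lt_or_ge t (-2) with ht | ht
    · have h : (fun t : ℝ ↦ Real.smoothTransition (t + 1) * A t) =ᶠ[𝓝 t] fun _ ↦ 0 := by
        filter_upwards [eventually_lt_nhds ht] with s hs
        rw [Real.smoothTransition.zero_of_nonpos (by linarith), zero_mul]
      rw [h.iteratedDeriv_eq k]
      have := (norm_nonneg _).trans (hD 0 (by norm_num))
      simp [this]
    rcases le_or_gt t 1 with ht1 | ht1
    · exact (hD t ⟨ht, ht1⟩).trans (le_max_right _ _)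
    · have h : (fun t : ℝ ↦ Real.smoothTransition (t + 1) * A t) =ᶠ[𝓝 t] A := by
        filter_upwards [eventually_gt_nhds ht1] with s hs
        rw [Real.smoothTransition.one_of_one_le (by linarith), one_mul]
      rw [h.iteratedDeriv_eq k]
      exact (hC t ht1.le).trans (le_max_left _ _)
  · rw [Real.smoothTransition.one_of_one_le (by nlinarith [sq_nonneg u]), one_mul, hsin]

/-- A smooth function on the line all of whose derivatives, of order zero included, are bounded. -/
structure BoundedDerivs_s13 (φ : ℝ → ℝ) : Prop where
  contDiff : ContDiff ℝ ∞ φ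
  bounded : ∀ k, ∃ C, ∀ t, |iteratedDeriv k φ t| ≤ C

theorem BoundedDerivs_s13.deriv {φ : ℝ → ℝ} (hφ : BoundedDerivs_s13 φ) : BoundedDerivs_s13 (deriv φ) where
  contDiff := (contDiff_infty_iff_deriv.1 hφ.contDiff).2
  bounded k := by
    rw [← iteratedDeriv_succ']
    exact hφ.bounded (k + 1)

section
variable {α E : Type*} [MeasurableSpace α] {μ : Measure α} {a b : α → ℝ}
  [NormedAddCommGroup E] [NormedSpace ℝ E]

theorem BoundedDerivs_s13.exists_integrable_smul_and_norm_le (ha : Measurable a) (hb : Measurable b)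
    {φ ψ : ℝ → ℝ} {F : α → E} (hφ : BoundedDerivs_s13 φ) (hψ : BoundedDerivs_s13 ψ)
    (hF : Integrable F μ) :
    ∃ C : ℝ, ∀ p : ℝ × ℝ, Integrable (fun w ↦ (φ (a w * p.1) * ψ (b w * p.2)) • F w) μ ∧
      ∀ w, ‖(φ (a w * p.1) * ψ (b w * p.2)) • F w‖ ≤ C * ‖F w‖ := by
  obtain ⟨C, hC⟩ := hφ.bounded 0
  obtain ⟨D, hD⟩ := hψ.bounded 0
  rw [iteratedDeriv_zero] at hC hD
  have hle : ∀ (p : ℝ × ℝ) w, ‖φ (a w * p.1) * ψ (b w * p.2)‖ ≤ C * D := fun p w ↦ by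
    rw [norm_mul]
    exact mul_le_mul (hC _) (hD _) (norm_nonneg _) ((abs_nonneg _).trans (hC 0))
  refine ⟨C * D, fun p ↦ ⟨?_, fun w ↦ ?_⟩⟩
  · refine hF.bdd_smul (C * D) ?_ (Eventually.of_forall (hle p))
    exact ((hφ.contDiff.continuous.measurable.comp (ha.mul_const _)).mul
      (hψ.contDiff.continuous.measurable.comp (hb.mul_const _))).aestronglyMeasurable
  · rw [norm_smul]
    gcongr
    exact hle p w

variable [CompleteSpace E]

theorem BoundedDerivs_s13.hasFDerivAt_integral_smul (ha : Measurable a) (hb : Measurable b)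
    {La Lb : E →L[ℝ] ℝ × ℝ →L[ℝ] E} (hLa : ∀ z q, La z q = q.1 • z)
    (hLb : ∀ z q, Lb z q = q.2 • z)
    {φ ψ : ℝ → ℝ} {F : α → E} (hφ : BoundedDerivs_s13 φ) (hψ : BoundedDerivs_s13 ψ)
    (hF : Integrable F μ) (hFa : Integrable (fun w ↦ a w • F w) μ)
    (hFb : Integrable (fun w ↦ b w • F w) μ) (p : ℝ × ℝ) :
    HasFDerivAt (fun p : ℝ × ℝ ↦ ∫ w, (φ (a w * p.1) * ψ (b w * p.2)) • F w ∂μ)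
      (La (∫ w, (_root_.deriv φ (a w * p.1) * ψ (b w * p.2)) • (a w • F w) ∂μ) +
        Lb (∫ w, (φ (a w * p.1) * _root_.deriv ψ (b w * p.2)) • (b w • F w) ∂μ)) p := by
  obtain ⟨C, hC⟩ := exists_integrable_smul_and_norm_le ha hb hφ hψ hF
  obtain ⟨Ca, hCa⟩ := exists_integrable_smul_and_norm_le ha hb hφ.deriv hψ hFa
  obtain ⟨Cb, hCb⟩ := exists_integrable_smul_and_norm_le ha hb hφ hψ.deriv hFb
  have hia := La.integrable_comp (hCa p).1
  have hib := Lb.integrable_comp (hCb p).1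
  rw [← La.integral_comp_comm (hCa p).1, ← Lb.integral_comp_comm (hCb p).1,
    ← integral_add hia hib]
  have hbound : Integrable (fun w ↦ ‖La‖ * (Ca * ‖a w • F w‖) + ‖Lb‖ * (Cb * ‖b w • F w‖)) μ :=
    ((hFa.norm.const_mul _).const_mul _).add ((hFb.norm.const_mul _).const_mul _)
  refine hasFDerivAt_integral_of_dominated_of_fderiv_le (𝕜 := ℝ) (s := univ)
    (F := fun p w ↦ (φ (a w * p.1) * ψ (b w * p.2)) • F w)
    (F' := fun p w ↦ La ((_root_.deriv φ (a w * p.1) * ψ (b w * p.2)) • (a w • F w)) +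
      Lb ((φ (a w * p.1) * _root_.deriv ψ (b w * p.2)) • (b w • F w)))
    univ_mem (Eventually.of_forall fun q ↦ (hC q).1.aestronglyMeasurable) (hC p).1
    ?_ (Eventually.of_forall fun w q _ ↦ ?_) hbound (Eventually.of_forall fun w q _ ↦ ?_)
  · exact hia.aestronglyMeasurable.fun_add hib.aestronglyMeasurable
  · exact (norm_add_le _ _).trans (add_le_add (La.le_opNorm_of_le ((hCa q).2 w))
      (Lb.le_opNorm_of_le ((hCb q).2 w)))
  · have h1 : HasFDerivAt (fun q : ℝ × ℝ ↦ φ (a w * q.1))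
        (_root_.deriv φ (a w * q.1) • a w • ContinuousLinearMap.fst ℝ ℝ ℝ) q :=
      ((hφ.contDiff.differentiable (by simp)) _).hasDerivAt.comp_hasFDerivAt q
        (hasFDerivAt_fst.const_mul (a w))
    have h2 : HasFDerivAt (fun q : ℝ × ℝ ↦ ψ (b w * q.2))
        (_root_.deriv ψ (b w * q.2) • b w • ContinuousLinearMap.snd ℝ ℝ ℝ) q :=
      ((hψ.contDiff.differentiable (by simp)) _).hasDerivAt.comp_hasFDerivAt q
        (hasFDerivAt_snd.const_mul (b w))
    refine ((h1.mul h2).smul_const (F w)).congr_fderiv ?_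
    ext <;> simp [hLa, hLb, smul_smul] <;> ring_nf

/-- Smoothness of a superposition of the dilated products `φ (a x) * ψ (b y)`, when `φ` and `ψ`
have bounded derivatives and the density has integrable moments in the dilation factors. -/
theorem BoundedDerivs_s13.contDiff_integral_smul (ha : Measurable a) (hb : Measurable b) (n : ℕ) :
    ∀ {φ ψ : ℝ → ℝ} {F : α → E}, BoundedDerivs_s13 φ → BoundedDerivs_s13 ψ →
      (∀ i j : ℕ, Integrable (fun w ↦ (a w ^ i * b w ^ j) • F w) μ) →
      ContDiff ℝ n fun p : ℝ × ℝ ↦ ∫ w, (φ (a w * p.1) * ψ (b w * p.2)) • F w ∂μ := by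
  obtain ⟨La, hLa⟩ : ∃ L : E →L[ℝ] ℝ × ℝ →L[ℝ] E, ∀ z q, L z q = q.1 • z :=
    ⟨ContinuousLinearMap.smulRightL ℝ (ℝ × ℝ) E (ContinuousLinearMap.fst ℝ ℝ ℝ), by simp⟩
  obtain ⟨Lb, hLb⟩ : ∃ L : E →L[ℝ] ℝ × ℝ →L[ℝ] E, ∀ z q, L z q = q.2 • z :=
    ⟨ContinuousLinearMap.smulRightL ℝ (ℝ × ℝ) E (ContinuousLinearMap.snd ℝ ℝ ℝ), by simp⟩
  have hmain {φ ψ : ℝ → ℝ} {F : α → E} (hφ : BoundedDerivs_s13 φ) (hψ : BoundedDerivs_s13 ψ)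
      (hF : ∀ i j : ℕ, Integrable (fun w ↦ (a w ^ i * b w ^ j) • F w) μ) :=
    hφ.hasFDerivAt_integral_smul ha hb hLa hLb hψ (by simpa using hF 0 0)
      (by simpa using hF 1 0) (by simpa using hF 0 1)
  induction n with
  | zero =>
    intro φ ψ F hφ hψ hF
    exact contDiff_zero.2 (continuous_iff_continuousAt.2 fun p ↦ (hmain hφ hψ hF p).continuousAt)
  | succ n ih =>
    intro φ ψ F hφ hψ hF
    refine contDiff_succ_iff_hasFDerivAt.2 ⟨_, ?_, hmain hφ hψ hF⟩
    have hmoment : ∀ i j k l : ℕ, Integrable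
        (fun w ↦ (a w ^ i * b w ^ j) • (a w ^ k * b w ^ l) • F w) μ := fun i j k l ↦ by
      refine (hF (i + k) (j + l)).congr (Eventually.of_forall fun w ↦ ?_)
      simp only [smul_smul]
      ring_nf
    refine (La.contDiff.comp (ih hφ.deriv hψ fun i j ↦ ?_)).add
      (Lb.contDiff.comp (ih hφ hψ.deriv fun i j ↦ ?_))
    · simpa using hmoment i j 1 0
    · simpa using hmoment i j 0 1

end

/-- A real integral representation of odd Schwartz functions in the plane. -/
theorem SchwartzMap.eq_neg_integral_sin_mul_sin (f : 𝓢(EuclideanSpace ℝ (Fin 2), ℂ))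
    (hodd₁ : ∀ u v, f !₂[-u, v] = -f !₂[u, v]) (hodd₂ : ∀ u v, f !₂[u, -v] = -f !₂[u, v])
    (u v : ℝ) :
    f !₂[u, v] = ∫ w : EuclideanSpace ℝ (Fin 2),
      (-(Real.sin (2 * Real.pi * w 0 * u) * Real.sin (2 * Real.pi * w 1 * v))) • 𝓕 f w := by
  let e (u v : ℝ) (w : EuclideanSpace ℝ (Fin 2)) : ℂ :=
    Complex.exp (((2 * Real.pi * w 0 * u + 2 * Real.pi * w 1 * v : ℝ) : ℂ) * Complex.I)
  have hinv (u v : ℝ) : f !₂[u, v] = ∫ w, e u v w • 𝓕 f w := by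
    conv_lhs =>
      rw [← FourierTransform.fourierInv_fourier_eq (F := 𝓢(EuclideanSpace ℝ (Fin 2), ℂ)) f,
        SchwartzMap.fourierInv_coe, Real.fourierInv_eq']
    refine integral_congr_ae (Eventually.of_forall fun w ↦ ?_)
    simp only [e, PiLp.inner_apply, Fin.sum_univ_two]
    congr 4
    simp
    ring
  have hint (u v : ℝ) : Integrable fun w ↦ e u v w • 𝓕 f w := by
    refine Integrable.bdd_smul (φ := e u v) (𝓕 f).integrable 1 ?_ (Eventually.of_forall fun w ↦ ?_)
    · refine Continuous.aestronglyMeasurable ?_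
      simp only [e]
      fun_prop
    · exact (Complex.norm_exp_ofReal_mul_I _).le
  have hsum : 4 * f !₂[u, v] = ∫ w, (e u v w • 𝓕 f w - e (-u) v w • 𝓕 f w)
      - (e u (-v) w • 𝓕 f w - e (-u) (-v) w • 𝓕 f w) := by
    have hdiff (v : ℝ) : Integrable fun w ↦ e u v w • 𝓕 f w - e (-u) v w • 𝓕 f w :=
      (hint u v).sub (hint (-u) v)
    rw [integral_sub (hdiff v) (hdiff (-v)),
      integral_sub (hint _ _) (hint _ _), integral_sub (hint _ _) (hint _ _),
      ← hinv, ← hinv, ← hinv, ← hinv, hodd₁, hodd₁, hodd₂]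
    ring
  refine mul_left_cancel₀ (show (4 : ℂ) ≠ 0 by norm_num) ?_
  rw [hsum, ← integral_const_mul]
  refine integral_congr_ae (Eventually.of_forall fun w ↦ ?_)
  simp only [e, Complex.real_smul, smul_eq_mul]
  push_cast
  simp only [Complex.sin, mul_neg, add_mul, Complex.exp_add, neg_mul]
  ring_nf
  simp only [Complex.I_sq]
  ring

/-- A compactly supported smooth function that is odd in each variable is the product of the
coordinates with a smooth function of their squares. -/
theorem exists_contDiff_eq_mul_comp_sq_s13 {f : ℝ × ℝ → ℝ} (hf : ContDiff ℝ ∞ f)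
    (hsupp : HasCompactSupport f) (hodd₁ : ∀ u v, f (-u, v) = -f (u, v))
    (hodd₂ : ∀ u v, f (u, -v) = -f (u, v)) :
    ∃ g : ℝ × ℝ → ℝ, ContDiff ℝ ∞ g ∧ ∀ u v, f (u, v) = u * v * g (u ^ 2, v ^ 2) := by
  obtain ⟨S, hS, hSb, hsin⟩ := exists_contDiff_bounded_mul_comp_sq_eq_sin
  let e : EuclideanSpace ℝ (Fin 2) ≃L[ℝ] ℝ × ℝ :=
    (EuclideanSpace.equiv (Fin 2) ℝ).trans (ContinuousLinearEquiv.finTwoArrow ℝ ℝ)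
  have hsupp' : HasCompactSupport fun w : EuclideanSpace ℝ (Fin 2) ↦ (f (e w) : ℂ) :=
    (hsupp.comp_homeomorph e.toHomeomorph).comp_left Complex.ofReal_zero
  let h : 𝓢(EuclideanSpace ℝ (Fin 2), ℂ) := hsupp'.toSchwartzMap
    (Complex.ofRealCLM.contDiff.comp (hf.comp e.contDiff))
  have hh (u v : ℝ) : h !₂[u, v] = f (u, v) := rfl
  let a (w : EuclideanSpace ℝ (Fin 2)) : ℝ := (2 * Real.pi * w 0) ^ 2
  let b (w : EuclideanSpace ℝ (Fin 2)) : ℝ := (2 * Real.pi * w 1) ^ 2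
  let F (w : EuclideanSpace ℝ (Fin 2)) : ℂ := (-(2 * Real.pi * w 0 * (2 * Real.pi * w 1))) • 𝓕 h w
  have ha : Continuous a := by fun_prop
  have hb : Continuous b := by fun_prop
  have hmoment (i j : ℕ) : Integrable fun w ↦ (a w ^ i * b w ^ j) • F w := by
    refine (((𝓕 h).integrable_pow_mul volume (2 * i + 2 * j + 2)).const_mul
      ((2 * Real.pi) ^ (2 * i + 2 * j + 2))).mono' ?_ (Eventually.of_forall fun w ↦ ?_)
    · refine Continuous.aestronglyMeasurable ?_
      have := (𝓕 h).continuous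
      fun_prop
    · have h0 : ‖w 0‖ ≤ ‖w‖ := PiLp.norm_apply_le w 0
      have h1 : ‖w 1‖ ≤ ‖w‖ := PiLp.norm_apply_le w 1
      have hpi : ‖Real.pi‖ = Real.pi := Real.norm_of_nonneg Real.pi_nonneg
      simp only [a, b, F, norm_smul, norm_mul, norm_pow, norm_neg, hpi, Real.norm_ofNat]
      calc _ ≤ ((2 * Real.pi * ‖w‖) ^ 2) ^ i * ((2 * Real.pi * ‖w‖) ^ 2) ^ j *
            (2 * Real.pi * ‖w‖ * (2 * Real.pi * ‖w‖) * ‖𝓕 h w‖) := by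
              gcongr
        _ = _ := by simp only [← pow_mul, mul_pow, pow_add]; ring
  have hG : ContDiff ℝ ∞ fun p : ℝ × ℝ ↦ ∫ w, (S (a w * p.1) * S (b w * p.2)) • F w :=
    contDiff_infty.2 fun n ↦ BoundedDerivs_s13.contDiff_integral_smul ha.measurable hb.measurable n
      ⟨hS, hSb⟩ ⟨hS, hSb⟩ hmoment
  refine ⟨_, Complex.reCLM.contDiff.comp hG, fun u v ↦ ?_⟩
  have hrep := h.eq_neg_integral_sin_mul_sin (fun u v ↦ by simp [hh, hodd₁])
    (fun u v ↦ by simp [hh, hodd₂]) u v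
  have hcomplex : (f (u, v) : ℂ) =
      ((u * v : ℝ) : ℂ) * ∫ w, (S (a w * u ^ 2) * S (b w * v ^ 2)) • F w := by
    rw [← hh, hrep, ← integral_const_mul]
    refine integral_congr_ae (Eventually.of_forall fun w ↦ ?_)
    simp only [a, b, F, ← hsin, ← mul_pow, Complex.real_smul]
    push_cast
    ring
  have := congrArg Complex.re hcomplex
  rwa [Complex.ofReal_re, Complex.re_ofReal_mul] at this

/-- Regularity of the cross term: if `(u,v) ↦ 4uv·γ(u²,v²)` (extended by `0`
on the axes) is smooth on `ℝ²`, then `γ` extends to a smooth function on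
`ℝ²`. -/
theorem stmt_13 (γ : ℝ × ℝ → ℝ) (γt : ℝ × ℝ → ℝ) (hγt : ContDiff ℝ (⊤ : ℕ∞) γt)
    (hcomp : ∀ u v : ℝ, u ≠ 0 → v ≠ 0 → γt (u, v) = 4 * u * v * γ (u ^ 2, v ^ 2))
    (hax : ∀ u v : ℝ, u * v = 0 → γt (u, v) = 0) :
    ∃ g : ℝ × ℝ → ℝ, ContDiff ℝ (⊤ : ℕ∞) g ∧
      ∀ x y : ℝ, 0 < x → 0 < y → g (x, y) = γ (x, y) := by
  have hγt' (u v : ℝ) : γt (u, v) = 4 * u * v * γ (u ^ 2, v ^ 2) := by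
    by_cases huv : u * v = 0
    · rw [hax u v huv]
      linear_combination (-4 * γ (u ^ 2, v ^ 2)) * huv
    · exact hcomp u v (left_ne_zero_of_mul huv) (right_ne_zero_of_mul huv)
  have hlocal (R : ℝ) (hR : 0 < R) : ∃ g : ℝ × ℝ → ℝ, ContDiff ℝ ∞ g ∧
      ∀ p ∈ Metric.ball (0 : ℝ × ℝ) R, 0 < p.1 → 0 < p.2 → g p = γ p := by
    let χ : ContDiffBump (0 : ℝ × ℝ) := ⟨R, R + 1, hR, lt_add_one R⟩
    have hχ : ContDiff ℝ ∞ fun p : ℝ × ℝ ↦ χ (p.1 ^ 2, p.2 ^ 2) :=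
      χ.contDiff.comp ((contDiff_fst.pow 2).prodMk (contDiff_snd.pow 2))
    have hsupp : HasCompactSupport fun p : ℝ × ℝ ↦ γt p * χ (p.1 ^ 2, p.2 ^ 2) := by
      refine HasCompactSupport.intro (isCompact_closedBall (0 : ℝ × ℝ) (R + 1)) fun p hp ↦ ?_
      rw [χ.zero_of_le_dist, mul_zero]
      rw [mem_closedBall_zero_iff, not_le, Prod.norm_def, lt_max_iff, Real.norm_eq_abs,
        Real.norm_eq_abs] at hp
      rw [dist_zero_right, Prod.norm_def, le_max_iff, Real.norm_eq_abs, Real.norm_eq_abs, abs_sq,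
        abs_sq, ← sq_abs p.1, ← sq_abs p.2]
      exact hp.imp (fun h ↦ by nlinarith) (fun h ↦ by nlinarith)
    obtain ⟨g, hg, hgeq⟩ := exists_contDiff_eq_mul_comp_sq_s13 (hγt.mul hχ) hsupp
      (fun u v ↦ by simp only [hγt', neg_sq]; ring)
      (fun u v ↦ by simp only [hγt', neg_sq]; ring)
    refine ⟨fun p ↦ 4⁻¹ * g p, contDiff_const.mul hg, fun ⟨x, y⟩ hp hx hy ↦ ?_⟩
    have hsx : 0 < √x := Real.sqrt_pos.2 hx
    have hsy : 0 < √y := Real.sqrt_pos.2 hy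
    have h := hgeq √x √y
    have hone : χ (x, y) = 1 := χ.one_of_mem_closedBall (Metric.ball_subset_closedBall hp)
    simp only [hγt', Real.sq_sqrt hx.le, Real.sq_sqrt hy.le, hone] at h
    refine mul_left_cancel₀ (mul_pos hsx hsy).ne' ?_
    linear_combination -4⁻¹ * h
  obtain ⟨g, hg⟩ := exists_contMDiffMap_forall_mem_convex_of_local (n := (⊤ : ℕ∞))
    (modelWithCornersSelf ℝ (ℝ × ℝ)) (t := fun p ↦ {z : ℝ | 0 < p.1 → 0 < p.2 → z = γ p})
    (fun p z hz w hw s t _ _ hst hx hy ↦ by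
      rw [hz hx hy, hw hx hy, ← add_smul, hst, one_smul])
    (fun p ↦ by
      obtain ⟨g, hg, hgγ⟩ := hlocal (‖p‖ + 1) (by positivity)
      exact ⟨_, Metric.isOpen_ball.mem_nhds (by simp), g, hg.contMDiff.contMDiffOn, hgγ⟩)
  exact ⟨g, g.contMDiff.contDiff, fun x y hx hy ↦ hg (x, y) hx hy⟩
end

section
/- Let α : (0,∞)² → ℝ be a function such that (u,v) ↦ 4·u²·α(u², v²) extends to a smooth function on ℝ². Then there exist a smooth function A : ℝ → ℝ and a smooth function Q : ℝ² → ℝ such that α(x,y) = A(y)/x + Q(x,y) for all x, y > 0. -/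
open scoped ContDiff Topology
open MeasureTheory

/-- The entire function `t ↦ cos √t` as a smooth function on the line. -/
theorem exists_contDiff_comp_sq_eq_cos :
    ∃ c : ℝ → ℝ, ContDiff ℝ ∞ c ∧ ∀ u, c (u ^ 2) = Real.cos u := by
  let a : ℕ → ℝ := fun n => (-1) ^ n / (2 * n).factorial
  have hrad : (FormalMultilinearSeries.ofScalars ℝ a).radius = ⊤ := by
    refine FormalMultilinearSeries.ofScalars_radius_eq_top_of_tendsto ℝ a
      (Filter.Eventually.of_forall fun n => by simp [a, Nat.factorial_ne_zero]) ?_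
    refine squeeze_zero (fun n => by positivity) (fun n => ?_)
      tendsto_one_div_add_atTop_nhds_zero_nat
    have h : ((2 * n.succ).factorial : ℝ) = (2 * n + 2) * ((2 * n + 1) * (2 * n).factorial) := by
      rw [show 2 * n.succ = 2 * n + 1 + 1 by omega, Nat.factorial_succ, Nat.factorial_succ]
      push_cast
      ring
    have hpos : (0 : ℝ) < (2 * n).factorial := by positivity
    simp only [a, norm_div, norm_pow, norm_neg, norm_one, one_pow, h, norm_mul, Real.norm_eq_abs,
      Nat.abs_cast]
    rw [abs_of_pos (by positivity : (0 : ℝ) < 2 * n + 2),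
      abs_of_pos (by positivity : (0 : ℝ) < 2 * n + 1), div_div_div_eq, one_mul, mul_one,
      div_le_div_iff₀ (by positivity) (by positivity)]
    have hn : (0 : ℝ) ≤ n := n.cast_nonneg
    nlinarith [mul_nonneg hpos.le hn, mul_nonneg (mul_nonneg hpos.le hn) hn]
  have hball := (FormalMultilinearSeries.ofScalars ℝ a).hasFPowerSeriesOnBall (by simp [hrad])
  rw [hrad] at hball
  refine ⟨(FormalMultilinearSeries.ofScalars ℝ a).sum, ?_, fun u => ?_⟩
  · refine contDiff_iff_contDiffAt.2 fun x => (hball.analyticAt_of_mem ?_).contDiffAt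
    simp
  · have h := hball.hasSum (y := u ^ 2) (by simp)
    rw [zero_add] at h
    refine h.unique ((Real.hasSum_cos u).congr_fun fun n => ?_)
    rw [FormalMultilinearSeries.ofScalars_apply_eq, smul_eq_mul, ← pow_mul]
    ring

open Polynomial in
theorem iteratedDeriv_eq_of_comp_sq_eq_cos {c : ℝ → ℝ} (hc : ∀ u, c (u ^ 2) = Real.cos u) (k : ℕ) :
    ∃ P Q : ℝ[X], ∀ t, 0 < t → iteratedDeriv k c t =
      P.eval (√t)⁻¹ * Real.cos √t + Q.eval (√t)⁻¹ * Real.sin √t := by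
  induction k with
  | zero =>
    refine ⟨1, 0, fun t ht => ?_⟩
    simp [← hc, Real.sq_sqrt ht.le]
  | succ k ih =>
    obtain ⟨P, Q, h⟩ := ih
    refine ⟨C (1 / 2) * (X * Q - X ^ 3 * derivative P), C (-1 / 2) * (X * P + X ^ 3 * derivative Q),
      fun t ht => ?_⟩
    have hev : iteratedDeriv k c =ᶠ[𝓝 t] fun t =>
        P.eval (√t)⁻¹ * Real.cos √t + Q.eval (√t)⁻¹ * Real.sin √t :=
      Filter.eventuallyEq_of_mem (Ioi_mem_nhds ht) fun s hs => h s hs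
    have hs := Real.hasDerivAt_sqrt ht.ne'
    have hpos := Real.sqrt_pos.2 ht
    have hi : HasDerivAt (fun x => (√x)⁻¹) _ t := hs.inv hpos.ne'
    have hd := (((P.hasDerivAt _).comp t hi).mul hs.cos).add
      (((Q.hasDerivAt _).comp t hi).mul hs.sin)
    rw [iteratedDeriv_succ, hev.deriv_eq]
    refine hd.deriv.trans ?_
    simp only [eval_mul, eval_C, eval_add, eval_sub, eval_X, eval_pow, Function.comp_apply]
    field_simp
    ring

/-- A smooth function restricting to `cos √t` on `t ≥ 0`, with all derivatives bounded. -/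
theorem exists_contDiff_bounded_comp_sq_eq_cos :
    ∃ c : ℝ → ℝ, ContDiff ℝ ∞ c ∧ (∀ u, c (u ^ 2) = Real.cos u) ∧
      ∀ k, ∃ C, ∀ t, |iteratedDeriv k c t| ≤ C := by
  obtain ⟨c₀, hc₀, hcos⟩ := exists_contDiff_comp_sq_eq_cos
  have hsm : ContDiff ℝ ∞ fun t => Real.smoothTransition (t + 2) * c₀ t :=
    (Real.smoothTransition.contDiff.comp (contDiff_id.add contDiff_const)).mul hc₀
  have hsq : ∀ u, Real.smoothTransition (u ^ 2 + 2) * c₀ (u ^ 2) = Real.cos u := fun u => by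
    rw [Real.smoothTransition.one_of_one_le (by nlinarith [sq_nonneg u]), one_mul, hcos]
  refine ⟨_, hsm, hsq, fun k => ?_⟩
  obtain ⟨P, Q, hPQ⟩ := iteratedDeriv_eq_of_comp_sq_eq_cos
    (c := fun t => Real.smoothTransition (t + 2) * c₀ t) hsq k
  have hcont := hsm.continuous_iteratedDeriv k (mod_cast le_top)
  obtain ⟨C₁, hC₁⟩ := isCompact_Icc.exists_bound_of_continuousOn
    (s := Set.Icc (-2 : ℝ) 1) hcont.continuousOn
  obtain ⟨C₂, hC₂⟩ := isCompact_Icc.exists_bound_of_continuousOn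
    (s := Set.Icc (0 : ℝ) 1) P.continuous.continuousOn
  obtain ⟨C₃, hC₃⟩ := isCompact_Icc.exists_bound_of_continuousOn
    (s := Set.Icc (0 : ℝ) 1) Q.continuous.continuousOn
  have hC₁0 : 0 ≤ C₁ := (norm_nonneg _).trans (hC₁ 0 (by simp))
  have hC₂0 : 0 ≤ C₂ := (norm_nonneg _).trans (hC₂ 0 (by simp))
  have hC₃0 : 0 ≤ C₃ := (norm_nonneg _).trans (hC₃ 0 (by simp))
  refine ⟨C₁ + (C₂ + C₃), fun t => ?_⟩
  rcases lt_or_ge t (-2) with ht | ht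
  · have hev : (fun t => Real.smoothTransition (t + 2) * c₀ t) =ᶠ[𝓝 t] fun _ => 0 :=
      Filter.eventuallyEq_of_mem (Iio_mem_nhds ht) fun s hs => by
        have hs' : s < -2 := hs
        simp [Real.smoothTransition.zero_of_nonpos (by linarith : s + 2 ≤ 0)]
    rw [hev.iteratedDeriv_eq]
    simp only [iteratedDeriv_fun_const_zero, abs_zero]
    positivity
  rcases le_total t 1 with ht1 | ht1
  · exact (hC₁ t ⟨ht, ht1⟩).trans (by linarith)
  · rw [hPQ t (by linarith)]
    have hmem : (√t)⁻¹ ∈ Set.Icc (0 : ℝ) 1 :=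
      ⟨by positivity, inv_le_one_of_one_le₀ (Real.one_le_sqrt.2 ht1)⟩
    have h₂ := hC₂ _ hmem
    have h₃ := hC₃ _ hmem
    rw [Real.norm_eq_abs] at h₂ h₃
    calc _ ≤ |P.eval (√t)⁻¹ * Real.cos √t| + |Q.eval (√t)⁻¹ * Real.sin √t| := abs_add_le _ _
      _ ≤ C₂ * 1 + C₃ * 1 := by
        rw [abs_mul, abs_mul]
        gcongr
        · exact Real.abs_cos_le_one _
        · exact Real.abs_sin_le_one _
      _ ≤ _ := by linarith

section OscillatoryIntegral

variable {Ω : Type*} [MeasurableSpace Ω] {μ : Measure Ω} {p q : Ω → ℝ} {c : ℝ → ℝ}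

theorem integrable_mul_iteratedDeriv_mul (hp : Measurable p) (hq : Measurable q)
    (hc : ContDiff ℝ ∞ c) (hb : ∀ k, ∃ C, ∀ t, |iteratedDeriv k c t| ≤ C) {G : Ω → ℝ}
    (hG : Integrable G μ) (i j : ℕ) (z : ℝ × ℝ) :
    Integrable (fun w => G w * (iteratedDeriv i c (p w * z.1) * iteratedDeriv j c (q w * z.2)))
      μ := by
  obtain ⟨C, hC⟩ := hb i
  obtain ⟨D, hD⟩ := hb j
  have hi := (hc.continuous_iteratedDeriv i (mod_cast le_top)).measurable
  have hj := (hc.continuous_iteratedDeriv j (mod_cast le_top)).measurable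
  refine hG.mul_bdd (c := C * D) (by fun_prop) (Filter.Eventually.of_forall fun w => ?_)
  rw [norm_mul]
  exact mul_le_mul (hC _) (hD _) (norm_nonneg _) ((abs_nonneg _).trans (hC 0))

theorem hasFDerivAt_integral_mul_iteratedDeriv (hp : Measurable p) (hq : Measurable q)
    (hc : ContDiff ℝ ∞ c) (hb : ∀ k, ∃ C, ∀ t, |iteratedDeriv k c t| ≤ C) {G : Ω → ℝ}
    (hG : Integrable G μ) (hpG : Integrable (fun w => p w * G w) μ)
    (hqG : Integrable (fun w => q w * G w) μ) (i j : ℕ) (z : ℝ × ℝ) :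
    HasFDerivAt (fun z : ℝ × ℝ =>
        ∫ w, G w * (iteratedDeriv i c (p w * z.1) * iteratedDeriv j c (q w * z.2)) ∂μ)
      ((∫ w, p w * G w * (iteratedDeriv (i + 1) c (p w * z.1) * iteratedDeriv j c (q w * z.2)) ∂μ) •
          ContinuousLinearMap.fst ℝ ℝ ℝ +
        (∫ w, q w * G w * (iteratedDeriv i c (p w * z.1) * iteratedDeriv (j + 1) c (q w * z.2)) ∂μ) •
          ContinuousLinearMap.snd ℝ ℝ ℝ) z := by
  have hint {G : Ω → ℝ} (hG : Integrable G μ) := integrable_mul_iteratedDeriv_mul hp hq hc hb hG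
  have hder (k : ℕ) (t : ℝ) : HasDerivAt (iteratedDeriv k c) (iteratedDeriv (k + 1) c t) t := by
    rw [iteratedDeriv_succ]
    exact ((hc.differentiable_iteratedDeriv k (mod_cast ENat.natCast_lt_top k)) t).hasDerivAt
  obtain ⟨C, hC⟩ := hb i
  obtain ⟨D, hD⟩ := hb j
  obtain ⟨C', hC'⟩ := hb (i + 1)
  obtain ⟨D', hD'⟩ := hb (j + 1)
  have hfst := (hint hpG (i + 1) j z).smul_const (ContinuousLinearMap.fst ℝ ℝ ℝ)
  have hsnd := (hint hqG i (j + 1) z).smul_const (ContinuousLinearMap.snd ℝ ℝ ℝ)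
  refine HasFDerivAt.congr_fderiv ?_ ((integral_add hfst hsnd).trans
    (congrArg₂ (· + ·) (integral_smul_const _ _) (integral_smul_const _ _)))
  refine hasFDerivAt_integral_of_dominated_of_fderiv_le
    (F := fun (z : ℝ × ℝ) w =>
      G w * (iteratedDeriv i c (p w * z.1) * iteratedDeriv j c (q w * z.2)))
    (F' := fun (z : ℝ × ℝ) w =>
      (p w * G w * (iteratedDeriv (i + 1) c (p w * z.1) * iteratedDeriv j c (q w * z.2))) •
          ContinuousLinearMap.fst ℝ ℝ ℝ +
        (q w * G w * (iteratedDeriv i c (p w * z.1) * iteratedDeriv (j + 1) c (q w * z.2))) •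
          ContinuousLinearMap.snd ℝ ℝ ℝ)
    (bound := fun w => ‖p w * G w‖ * (C' * D) + ‖q w * G w‖ * (C * D'))
    Filter.univ_mem (Filter.Eventually.of_forall fun z => (hint hG i j z).aestronglyMeasurable)
    (hint hG i j z) (hfst.add hsnd).aestronglyMeasurable
    (Filter.Eventually.of_forall fun w z _ => ?_)
    ((hpG.norm.mul_const _).add (hqG.norm.mul_const _))
    (Filter.Eventually.of_forall fun w z _ => ?_)
  · have h0 : 0 ≤ C := (abs_nonneg _).trans (hC 0)
    have h0' : 0 ≤ C' := (abs_nonneg _).trans (hC' 0)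
    refine (norm_add_le _ _).trans (add_le_add ?_ ?_)
    · rw [norm_smul, norm_mul, norm_mul (iteratedDeriv _ _ _)]
      refine (mul_le_of_le_one_right (by positivity)
        (ContinuousLinearMap.norm_fst_le ℝ ℝ ℝ)).trans ?_
      gcongr
      exacts [hC' _, hD _]
    · rw [norm_smul, norm_mul, norm_mul (iteratedDeriv _ _ _)]
      refine (mul_le_of_le_one_right (by positivity)
        (ContinuousLinearMap.norm_snd_le ℝ ℝ ℝ)).trans ?_
      gcongr
      exacts [hC _, hD' _]
  · have h1 := (hder i (p w * z.1)).comp_hasFDerivAt z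
      ((ContinuousLinearMap.fst ℝ ℝ ℝ).hasFDerivAt.const_mul (p w))
    have h2 := (hder j (q w * z.2)).comp_hasFDerivAt z
      ((ContinuousLinearMap.snd ℝ ℝ ℝ).hasFDerivAt.const_mul (q w))
    refine ((h1.mul h2).const_mul (G w)).congr_fderiv ?_
    ext <;> simp <;> ring

theorem contDiff_integral_mul_iteratedDeriv (hp : Measurable p) (hq : Measurable q)
    (hc : ContDiff ℝ ∞ c) (hb : ∀ k, ∃ C, ∀ t, |iteratedDeriv k c t| ≤ C) (n : ℕ) {G : Ω → ℝ}
    (hG : ∀ m k, Integrable (fun w => p w ^ m * q w ^ k * G w) μ) (i j : ℕ) :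
    ContDiff ℝ n (fun z : ℝ × ℝ =>
      ∫ w, G w * (iteratedDeriv i c (p w * z.1) * iteratedDeriv j c (q w * z.2)) ∂μ) := by
  induction n generalizing G i j with
  | zero =>
    refine contDiff_zero.2 (continuous_iff_continuousAt.2 fun z => ?_)
    exact (hasFDerivAt_integral_mul_iteratedDeriv hp hq hc hb (by simpa using hG 0 0)
      (by simpa using hG 1 0) (by simpa using hG 0 1) i j z).continuousAt
  | succ n ih =>
    refine contDiff_succ_iff_hasFDerivAt.2 ⟨_, ?_, fun z =>
      hasFDerivAt_integral_mul_iteratedDeriv hp hq hc hb (by simpa using hG 0 0)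
      (by simpa using hG 1 0) (by simpa using hG 0 1) i j z⟩
    refine ((ih (fun m k => ?_) _ _).smul contDiff_const).add
      ((ih (fun m k => ?_) _ _).smul contDiff_const)
    · refine (hG (m + 1) k).congr (Filter.Eventually.of_forall fun w => ?_)
      simp only
      ring
    · refine (hG m (k + 1)).congr (Filter.Eventually.of_forall fun w => ?_)
      simp only
      ring

end OscillatoryIntegral

open scoped FourierTransform SchwartzMap in
/-- The cosine-transform form of Fourier inversion in the plane. -/
theorem SchwartzMap.sum_reflections_eq_integral (g : 𝓢(EuclideanSpace ℝ (Fin 2), ℂ)) (u v : ℝ) :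
    g !₂[u, v] + g !₂[-u, v] + g !₂[u, -v] + g !₂[-u, -v] =
      4 * ∫ w : EuclideanSpace ℝ (Fin 2), 𝓕 g w *
        (Real.cos (2 * Real.pi * w 0 * u) * Real.cos (2 * Real.pi * w 1 * v) : ℝ) := by
  have hinv (x : EuclideanSpace ℝ (Fin 2)) :
      g x = ∫ w, Complex.exp (↑(2 * Real.pi * inner ℝ w x) * Complex.I) * 𝓕 g w := by
    have h := g.continuous.fourierInv_fourier_eq g.integrable (𝓕 g).integrable
    rw [← h, Real.fourierInv_eq']
    rfl
  have hint (x : EuclideanSpace ℝ (Fin 2)) : Integrable fun w =>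
      Complex.exp (↑(2 * Real.pi * inner ℝ w x) * Complex.I) * 𝓕 g w :=
    (𝓕 g).integrable.bdd_mul (c := 1) (by fun_prop)
      (Filter.Eventually.of_forall fun w => (Complex.norm_exp_ofReal_mul_I _).le)
  rw [hinv, hinv, hinv, hinv, ← integral_add (hint _) (hint _),
    ← integral_add ((hint _).fun_add (hint _)) (hint _),
    ← integral_add (((hint _).fun_add (hint _)).fun_add (hint _)) (hint _), ← integral_const_mul]
  refine integral_congr_ae (Filter.Eventually.of_forall fun w => ?_)
  simp only [PiLp.inner_apply, Fin.sum_univ_two, RCLike.inner_apply, conj_trivial]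
  push_cast
  rw [Complex.cos, Complex.cos]
  have h (a b : ℂ) : Complex.exp ((a + b) * Complex.I) =
      Complex.exp (a * Complex.I) * Complex.exp (b * Complex.I) := by
    rw [add_mul, Complex.exp_add]
  have hpospos : (2 * Real.pi * (u * w 0 + v * w 1) : ℂ) =
      2 * Real.pi * w 0 * u + 2 * Real.pi * w 1 * v := by
    ring
  have hnegpos : (2 * Real.pi * (-u * w 0 + v * w 1) : ℂ) =
      -(2 * Real.pi * w 0 * u) + 2 * Real.pi * w 1 * v := by
    ring
  have hposneg : (2 * Real.pi * (u * w 0 + -v * w 1) : ℂ) =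
      2 * Real.pi * w 0 * u + -(2 * Real.pi * w 1 * v) := by
    ring
  have hnegneg : (2 * Real.pi * (-u * w 0 + -v * w 1) : ℂ) =
      -(2 * Real.pi * w 0 * u) + -(2 * Real.pi * w 1 * v) := by
    ring
  rw [hpospos, hnegpos, hposneg, hnegneg, h, h, h, h]
  ring

open scoped FourierTransform SchwartzMap in
/-- The average of a test function over sign changes of the coordinates is a smooth function of
the squares of the coordinates. -/
theorem exists_contDiff_comp_sq_eq_average {g : EuclideanSpace ℝ (Fin 2) → ℝ}
    (hg : ContDiff ℝ ∞ g) (hs : HasCompactSupport g) :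
    ∃ F : ℝ × ℝ → ℝ, ContDiff ℝ ∞ F ∧ ∀ u v : ℝ,
      F (u ^ 2, v ^ 2) = (g !₂[u, v] + g !₂[-u, v] + g !₂[u, -v] + g !₂[-u, -v]) / 4 := by
  obtain ⟨c, hc, hcos, hb⟩ := exists_contDiff_bounded_comp_sq_eq_cos
  have hgc : HasCompactSupport fun x => (g x : ℂ) := hs.comp_left Complex.ofReal_zero
  let φ : 𝓢(EuclideanSpace ℝ (Fin 2), ℂ) :=
    hgc.toSchwartzMap (Complex.ofRealCLM.contDiff.comp hg)
  let p : EuclideanSpace ℝ (Fin 2) → ℝ := fun w => (2 * Real.pi * w 0) ^ 2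
  let q : EuclideanSpace ℝ (Fin 2) → ℝ := fun w => (2 * Real.pi * w 1) ^ 2
  have hp : Continuous p := by fun_prop
  have hq : Continuous q := by fun_prop
  have hre : Continuous fun w => (𝓕 φ w).re := Complex.continuous_re.comp (𝓕 φ).continuous
  refine ⟨fun z => ∫ w, (𝓕 φ w).re *
    (iteratedDeriv 0 c (p w * z.1) * iteratedDeriv 0 c (q w * z.2)), ?_, fun u v => ?_⟩
  · refine contDiff_infty.2 fun n =>
      contDiff_integral_mul_iteratedDeriv hp.measurable hq.measurable hc hb n (fun m k => ?_) 0 0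
    refine (((𝓕 φ).integrable_pow_mul volume (2 * m + 2 * k)).const_mul
      ((2 * Real.pi) ^ (2 * m + 2 * k))).mono' (by fun_prop)
      (Filter.Eventually.of_forall fun w => ?_)
    have hcoord (i : Fin 2) (n : ℕ) :
        ‖((2 * Real.pi * w i) ^ 2) ^ n‖ ≤ (2 * Real.pi * ‖w‖) ^ (2 * n) := by
      rw [← pow_mul, norm_pow, norm_mul, Real.norm_of_nonneg Real.two_pi_pos.le]
      have := PiLp.norm_apply_le w i
      have := Real.two_pi_pos
      gcongr
    rw [norm_mul, norm_mul]
    calc _ ≤ (2 * Real.pi * ‖w‖) ^ (2 * m) * (2 * Real.pi * ‖w‖) ^ (2 * k) * ‖𝓕 φ w‖ := by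
          have := Real.two_pi_pos
          gcongr
          exacts [hcoord 0 m, hcoord 1 k, Complex.abs_re_le_norm _]
      _ = _ := by ring
  · have hφ (x : EuclideanSpace ℝ (Fin 2)) : φ x = g x := rfl
    have hint : Integrable fun w => 𝓕 φ w *
        (Real.cos (2 * Real.pi * w 0 * u) * Real.cos (2 * Real.pi * w 1 * v) : ℝ) := by
      refine (𝓕 φ).integrable.mul_bdd (c := 1) (by fun_prop)
        (Filter.Eventually.of_forall fun w => ?_)
      rw [Complex.norm_real, norm_mul]
      exact mul_le_one₀ (Real.abs_cos_le_one _) (norm_nonneg _) (Real.abs_cos_le_one _)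
    have h := congrArg Complex.re (φ.sum_reflections_eq_integral u v)
    have hre_int := integral_re hint
    simp only [RCLike.re_eq_complex_re, Complex.re_mul_ofReal] at hre_int
    rw [← Complex.ofReal_ofNat, Complex.re_ofReal_mul, ← hre_int] at h
    simp only [hφ, Complex.add_re, Complex.ofReal_re] at h
    rw [h, mul_div_cancel_left₀ _ four_ne_zero]
    simp only [iteratedDeriv_zero, p, q, ← mul_pow, hcos]

/-- Whitney's theorem on even functions, in two variables. -/
theorem exists_contDiff_comp_sq_eq_of_even {f : ℝ × ℝ → ℝ} (hf : ContDiff ℝ ∞ f)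
    (hleft : ∀ u v, f (-u, v) = f (u, v)) (hright : ∀ u v, f (u, -v) = f (u, v)) :
    ∃ F : ℝ × ℝ → ℝ, ContDiff ℝ ∞ F ∧ ∀ u v : ℝ, F (u ^ 2, v ^ 2) = f (u, v) := by
  let t : ℝ × ℝ → Set ℝ := fun z => {y | ∀ u v, (u ^ 2, v ^ 2) = z → y = f (u, v)}
  have ht (z : ℝ × ℝ) : Convex ℝ (t z) := by
    intro y₁ h₁ y₂ h₂ a b _ _ hab u v huv
    rw [h₁ u v huv, h₂ u v huv, ← add_smul, hab, one_smul]
  obtain ⟨F, hF⟩ := exists_contMDiffMap_forall_mem_convex_of_local (n := ⊤)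
    (modelWithCornersSelf ℝ (ℝ × ℝ)) ht fun z => by
      let R : ℝ := |z.1| + |z.2| + 1
      have hR : 1 ≤ R := by
        have := abs_nonneg z.1
        have := abs_nonneg z.2
        simp only [R]
        linarith
      let χ : ContDiffBump (0 : EuclideanSpace ℝ (Fin 2)) :=
        ⟨2 * R, 2 * R + 1, by linarith, by linarith⟩
      have hχ (u v : ℝ) (hu : u ^ 2 < R) (hv : v ^ 2 < R) : χ !₂[u, v] = 1 := by
        refine χ.one_of_mem_closedBall (mem_closedBall_zero_iff.2 ?_)
        refine abs_le_of_sq_le_sq' ?_ (by linarith) |>.2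
        rw [EuclideanSpace.norm_sq_eq]
        simp only [Fin.sum_univ_two, Real.norm_eq_abs, sq_abs, Matrix.cons_val_zero,
          Matrix.cons_val_one, Matrix.cons_val_fin_one]
        nlinarith
      obtain ⟨F, hF, hFsq⟩ := exists_contDiff_comp_sq_eq_average
        (g := fun x => χ x * f (x 0, x 1))
        (χ.contDiff.mul (hf.comp (by fun_prop)))
        χ.hasCompactSupport.mul_right
      refine ⟨{z | z.1 < R} ∩ {z | z.2 < R}, ?_, F, hF.contMDiff.contMDiffOn, ?_⟩
      · refine ((isOpen_lt continuous_fst continuous_const).inter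
          (isOpen_lt continuous_snd continuous_const)).mem_nhds ⟨?_, ?_⟩
        · have := le_abs_self z.1
          have := abs_nonneg z.2
          simp only [R, Set.mem_ofPred_eq]
          linarith
        · have := le_abs_self z.2
          have := abs_nonneg z.1
          simp only [R, Set.mem_ofPred_eq]
          linarith
      · rintro _ ⟨hu, hv⟩ u v rfl
        simp only [Set.mem_ofPred_eq] at hu hv
        rw [hFsq, hχ u v hu hv, hχ (-u) v (by simpa using hu) hv, hχ u (-v) hu (by simpa using hv),
          hχ (-u) (-v) (by simpa using hu) (by simpa using hv)]
        simp only [Matrix.cons_val_zero, Matrix.cons_val_one, Matrix.cons_val_fin_one, hleft,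
          hright]
        ring
  exact ⟨F, F.contMDiff.contDiff, fun u v => hF _ u v rfl⟩

open Convolution in
/-- A smooth function stays smooth after integrating one variable over the unit interval. -/
theorem ContDiff.integral_zero_one {E : Type*} [NormedAddCommGroup E] [NormedSpace ℝ E]
    {G : E → ℝ → ℝ} (hG : ContDiff ℝ ∞ ↿G) : ContDiff ℝ ∞ fun z => ∫ t in (0 : ℝ)..1, G z t := by
  let χ : ContDiffBump (0 : ℝ) := ⟨1, 2, by norm_num, by norm_num⟩
  have h := contDiffOn_convolution_right_with_param_comp (n := ⊤) (μ := volume) (s := Set.univ)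
    (f := Set.indicator (Set.Ioc 0 1) fun _ => (1 : ℝ)) (v := fun _ : E => (0 : ℝ))
    (g := fun z s => χ s * G z (-s)) (k := tsupport χ) (ContinuousLinearMap.mul ℝ ℝ)
    contDiffOn_const isOpen_univ χ.hasCompactSupport
    (fun z s _ hs => by simp [image_eq_zero_of_notMem_tsupport hs])
    ((integrable_indicator_iff measurableSet_Ioc).2 (by simp)).locallyIntegrable
    ((χ.contDiff.comp contDiff_snd).mul
      (hG.comp (contDiff_fst.prodMk contDiff_snd.neg))).contDiffOn
  refine cast (congrArg (ContDiff ℝ ∞) (funext fun z => ?_)) (contDiffOn_univ.1 h)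
  symm
  rw [intervalIntegral.integral_of_le zero_le_one, ← integral_indicator measurableSet_Ioc,
    convolution_def]
  refine integral_congr_ae (Filter.Eventually.of_forall fun t => ?_)
  by_cases ht : t ∈ Set.Ioc (0 : ℝ) 1
  · have : χ (-t) = 1 := χ.one_of_mem_closedBall (by
      rw [mem_closedBall_zero_iff, norm_neg, Real.norm_of_nonneg ht.1.le]
      exact ht.2)
    simp [ht, this]
  · simp [ht]

/-- Hadamard's lemma in the first variable, with a parameter. -/
theorem ContDiff.exists_eq_add_fst_mul {F : ℝ × ℝ → ℝ} (hF : ContDiff ℝ ∞ F) :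
    ∃ Q : ℝ × ℝ → ℝ, ContDiff ℝ ∞ Q ∧ ∀ x y, F (x, y) = F (0, y) + x * Q (x, y) := by
  refine ⟨fun z => ∫ t in (0 : ℝ)..1, fderiv ℝ F (t * z.1, z.2) (1, 0),
    ContDiff.integral_zero_one ?_, fun x y => ?_⟩
  · have h : ContDiff ℝ ∞ (fderiv ℝ F) := hF.fderiv_right (by simp)
    exact (h.comp ((contDiff_snd.mul (contDiff_fst.comp contDiff_fst)).prodMk
      (contDiff_snd.comp contDiff_fst))).clm_apply contDiff_const
  · have hd (t : ℝ) : HasDerivAt (fun t => F (t * x, y)) (x * fderiv ℝ F (t * x, y) (1, 0)) t := by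
      have h := (hF.differentiable (by simp) (t * x, y)).hasFDerivAt.comp_hasDerivAt t
        (((hasDerivAt_id t).mul_const x).prodMk (hasDerivAt_const t y))
      refine h.congr_deriv ?_
      rw [← smul_eq_mul x, ← map_smul]
      simp
    have hcont : Continuous fun t : ℝ => x * fderiv ℝ F (t * x, y) (1, 0) := by
      have := hF.continuous_fderiv (by simp)
      fun_prop
    have h := intervalIntegral.integral_eq_sub_of_hasDerivAt (fun t _ => hd t)
      (hcont.intervalIntegrable 0 1)
    rw [intervalIntegral.integral_const_mul] at h
    simp only [one_mul, zero_mul] at h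
    rw [h]
    ring

/-- Axial term decomposition in the quadrant: if `(u,v) ↦ 4u²·α(u²,v²)`
extends to a smooth function on `ℝ²`, then `α(x,y) = A(y)/x + Q(x,y)` on the
open quadrant, with `A` and `Q` smooth. -/
theorem stmt_14 (α : ℝ × ℝ → ℝ) (αt : ℝ × ℝ → ℝ) (hαt : ContDiff ℝ (⊤ : ℕ∞) αt)
    (hcomp : ∀ u v : ℝ, u ≠ 0 → αt (u, v) = 4 * u ^ 2 * α (u ^ 2, v ^ 2)) :
    ∃ (A : ℝ → ℝ) (Q : ℝ × ℝ → ℝ), ContDiff ℝ (⊤ : ℕ∞) A ∧ ContDiff ℝ (⊤ : ℕ∞) Q ∧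
      ∀ x y : ℝ, 0 < x → 0 < y → α (x, y) = A y / x + Q (x, y) := by
  have hleft (u v : ℝ) : αt (-u, v) = αt (u, v) := by
    rcases eq_or_ne u 0 with rfl | hu
    · simp
    · rw [hcomp _ _ hu, hcomp _ _ (neg_ne_zero.2 hu), neg_sq]
  have hright (u v : ℝ) : αt (u, -v) = αt (u, v) := by
    have hcont := hαt.continuous
    have h : Set.EqOn (fun u => αt (u, -v)) (fun u => αt (u, v)) {0}ᶜ := fun u hu => by
      simp only [hcomp u _ hu, neg_sq]
    exact congrFun (Continuous.ext_on (dense_compl_singleton 0) (by fun_prop) (by fun_prop) h) u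
  obtain ⟨F, hF, hFsq⟩ := exists_contDiff_comp_sq_eq_of_even hαt hleft hright
  obtain ⟨Q, hQ, hFQ⟩ := hF.exists_eq_add_fst_mul
  refine ⟨fun y => F (0, y) / 4, fun z => Q z / 4,
    (hF.comp (contDiff_const.prodMk contDiff_id)).div_const 4, hQ.div_const 4,
    fun x y hx hy => ?_⟩
  have h := hFsq √x √y
  rw [hcomp _ _ (Real.sqrt_pos.2 hx).ne', Real.sq_sqrt hx.le, Real.sq_sqrt hy.le, hFQ] at h
  field_simp
  linarith
end
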